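/- arXiv:1209.3684 — 3 statements merged into one kernel-verified Lean document; each statement's English description precedes it below -/
import Mathlib

section
/- Let ψ be a smooth global finite-energy 1-equivariant wave map with ψ(t,∞) = kπ for all t, where k is a fixed integer. Then for every λ > 0, sup_{r ≥ λt} |ψ(t,r) − kπ| → 0 as t → ∞. -/
open MeasureTheory Real Filter Set

noncomputable section

/-- The ground state harmonic map `Q(r) = 2 arctan r`. -/
def Q (r : ℝ) : ℝ := 2 * Real.arctan r

/-- Time derivative `∂ₜψ(t,r)`. -/
def pT (ψ : ℝ → ℝ → ℝ) (t r : ℝ) : ℝ := deriv (fun s => ψ s r) t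

/-- Radial derivative `∂ᵣψ(t,r)`. -/
def pR (ψ : ℝ → ℝ → ℝ) (t r : ℝ) : ℝ := deriv (fun ρ => ψ t ρ) r

/-- Energy density `((∂ₜψ)² + (∂ᵣψ)² + sin²ψ/r²) · r`. -/
def eDen (ψ : ℝ → ℝ → ℝ) (t r : ℝ) : ℝ :=
  ((pT ψ t r) ^ 2 + (pR ψ t r) ^ 2 + (Real.sin (ψ t r)) ^ 2 / r ^ 2) * r

/-- Localized energy `E_{r₁}^{r₂}(ψ⃗(t))`. -/
def locE (ψ : ℝ → ℝ → ℝ) (t r₁ r₂ : ℝ) : ℝ := ∫ r in Set.Ioc r₁ r₂, eDen ψ t r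

/-- Total energy `E(ψ⃗(t))`. -/
def totE (ψ : ℝ → ℝ → ℝ) (t : ℝ) : ℝ := ∫ r in Set.Ioi (0:ℝ), eDen ψ t r

/-- `ψ` is a smooth global 1-equivariant wave map on `[0,∞) × (0,∞)`. -/
def IsWaveMap (ψ : ℝ → ℝ → ℝ) : Prop :=
  ContDiffOn ℝ (⊤ : ℕ∞) (fun p : ℝ × ℝ => ψ p.1 p.2) (Set.Ici (0:ℝ) ×ˢ Set.Ioi (0:ℝ)) ∧
  ∀ t r : ℝ, 0 ≤ t → 0 < r →
    deriv (fun s => pT ψ s r) t - deriv (fun ρ => pR ψ t ρ) r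
      - (1 / r) * pR ψ t r + Real.sin (2 * ψ t r) / (2 * r ^ 2) = 0

/-- Finite energy: the energy density is integrable at each time `t ≥ 0`. -/
def FiniteEnergy (ψ : ℝ → ℝ → ℝ) : Prop :=
  ∀ t : ℝ, 0 ≤ t → MeasureTheory.IntegrableOn (eDen ψ t) (Set.Ioi 0) volume

/-- The energy is conserved. -/
def EnergyConserved (ψ : ℝ → ℝ → ℝ) : Prop :=
  ∀ t : ℝ, 0 ≤ t → totE ψ t = totE ψ 0

/-- Squared `H × L²` norm density `(ψ₁² + (∂ᵣψ₀)² + ψ₀²/r²) · r`. -/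
def hl2Den (f g : ℝ → ℝ) (r : ℝ) : ℝ :=
  ((g r) ^ 2 + (deriv f r) ^ 2 + (f r) ^ 2 / r ^ 2) * r

/-- Squared `H × L²` norm of the pair `(f, g)` over the set of radii `S`. -/
def hl2Sq (f g : ℝ → ℝ) (S : Set ℝ) : ℝ := ∫ r in S, hl2Den f g r

/-- Squared `H` norm of `f` over the set of radii `S`. -/
def hSq (f : ℝ → ℝ) (S : Set ℝ) : ℝ :=
  ∫ r in S, ((deriv f r) ^ 2 + (f r) ^ 2 / r ^ 2) * r

/-- Squared (radial) `L²` norm. -/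
def l2Sq (g : ℝ → ℝ) : ℝ := ∫ r in Set.Ioi (0:ℝ), (g r) ^ 2 * r

/-- Wave map energy of a pair of data `(f, g)`. -/
def pairE (f g : ℝ → ℝ) : ℝ :=
  ∫ r in Set.Ioi (0:ℝ), ((g r) ^ 2 + (deriv f r) ^ 2 + (Real.sin (f r)) ^ 2 / r ^ 2) * r

/-- `φ` is a smooth solution of the linearized equation
`φ_tt − φ_rr − (1/r) φ_r + φ/r² = 0` on `ℝ × (0,∞)`. -/
def IsLinearWave (φ : ℝ → ℝ → ℝ) : Prop :=
  ContDiffOn ℝ (⊤ : ℕ∞) (fun p : ℝ × ℝ => φ p.1 p.2) (Set.univ ×ˢ Set.Ioi (0:ℝ)) ∧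
  ∀ t r : ℝ, 0 < r →
    deriv (fun s => pT φ s r) t - deriv (fun ρ => pR φ t ρ) r
      - (1 / r) * pR φ t r + φ t r / r ^ 2 = 0

/-- A linear wave has finite energy: its `H × L²` density is integrable at each time. -/
def LinFiniteEnergy (φ : ℝ → ℝ → ℝ) : Prop :=
  ∀ t : ℝ, MeasureTheory.IntegrableOn (hl2Den (φ t) (pT φ t)) (Set.Ioi 0) volume

/-- Degree one boundary conditions: `ψ(t,0⁺) = 0`, `ψ(t,∞) = π`. -/
def DegreeOneBC (ψ : ℝ → ℝ → ℝ) : Prop :=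
  ∀ t : ℝ, 0 ≤ t →
    Filter.Tendsto (ψ t) (nhdsWithin 0 (Set.Ioi 0)) (nhds 0) ∧
    Filter.Tendsto (ψ t) Filter.atTop (nhds Real.pi)

/-- Degree zero boundary conditions: `φ(t,0⁺) = 0`, `φ(t,∞) = 0`. -/
def DegreeZeroBC (φ : ℝ → ℝ → ℝ) : Prop :=
  ∀ t : ℝ, 0 ≤ t →
    Filter.Tendsto (φ t) (nhdsWithin 0 (Set.Ioi 0)) (nhds 0) ∧
    Filter.Tendsto (φ t) Filter.atTop (nhds 0)

/-- A function with nonpositive derivative on `[a, b]` does not increase from `a` to `b`. -/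
theorem le_of_hasDerivAt_nonpos {f f' : ℝ → ℝ} {a b : ℝ} (hab : a ≤ b)
    (hf : ∀ x ∈ Icc a b, HasDerivAt f (f' x) x) (hf' : ∀ x ∈ Icc a b, f' x ≤ 0) :
    f b ≤ f a := by
  have h : AntitoneOn f (Icc a b) := by
    refine antitoneOn_of_deriv_nonpos (convex_Icc a b)
      (fun x hx => (hf x hx).continuousAt.continuousWithinAt) ?_ ?_
    · intro x hx
      exact (hf x (interior_subset hx)).differentiableAt.differentiableWithinAt
    · intro x hx
      rw [(hf x (interior_subset hx)).deriv]
      exact hf' x (interior_subset hx)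
  exact h (left_mem_Icc.2 hab) (right_mem_Icc.2 hab) hab

/-- An energy potential `w` in null coordinates `0 < u < v`: `a` and `b` are the outgoing and
incoming flux densities, and `l` is the mixed derivative, controlled by `√(a b) / (v - u)`. -/
structure IsNullPotential (w a b l : ℝ → ℝ → ℝ) : Prop where
  hasDerivAt_right : ∀ u v, 0 < u → u < v → HasDerivAt (fun y => w u y) (a u v) v
  hasDerivAt_left : ∀ u v, 0 < u → u < v → HasDerivAt (fun x => w x v) (-(b u v)) u
  hasDerivAt_flux : ∀ u v, 0 < u → u < v → HasDerivAt (fun x => a x v) (l u v) u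
  right_nonneg : ∀ u v, 0 < u → u < v → 0 ≤ a u v
  left_nonneg : ∀ u v, 0 < u → u < v → 0 ≤ b u v
  sq_le : ∀ u v, 0 < u → u < v → (v - u) ^ 2 * l u v ^ 2 ≤ 25 * (a u v * b u v)

namespace IsNullPotential

variable {w a b l : ℝ → ℝ → ℝ}

theorem mono_right (h : IsNullPotential w a b l) {u v v' : ℝ} (hu : 0 < u) (huv : u < v)
    (hv : v ≤ v') : w u v ≤ w u v' := by
  have := le_of_hasDerivAt_nonpos (f := fun y => -w u y) (f' := fun y => -a u y) hv
    (fun x hx => (h.hasDerivAt_right u x hu (huv.trans_le hx.1)).neg)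
    (fun x hx => neg_nonpos.2 (h.right_nonneg u x hu (huv.trans_le hx.1)))
  simpa using this

theorem anti_left (h : IsNullPotential w a b l) {u u' v : ℝ} (hu : 0 < u) (huu : u ≤ u')
    (hv : u' < v) : w u' v ≤ w u v :=
  le_of_hasDerivAt_nonpos (f := fun x => w x v) (f' := fun x => -(b x v)) huu
    (fun x hx => h.hasDerivAt_left x v (hu.trans_le hx.1) (hx.2.trans_lt hv))
    (fun x hx => neg_nonpos.2 (h.left_nonneg x v (hu.trans_le hx.1) (hx.2.trans_lt hv)))

/-- Weighted Cauchy–Schwarz bound for the mixed derivative. -/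
theorem mixed_le (h : IsNullPotential w a b l) {u v p q θ : ℝ} (hθ : θ < 1) (hu : 0 < u)
    (huv : u ≤ θ * v) (hv : 0 < v) (hp : 0 ≤ p) (hq : 0 ≤ q)
    (hpq : 25 ≤ 4 * (p * q) * ((1 - θ) * v) ^ 2) :
    l u v ≤ p * a u v + q * b u v := by
  have hlt : u < v := by nlinarith
  have ha := h.right_nonneg u v hu hlt
  have hb := h.left_nonneg u v hu hlt
  have hsq := h.sq_le u v hu hlt
  have hd : 0 < (1 - θ) * v := mul_pos (by linarith) hv
  have hdu : (1 - θ) * v ≤ v - u := by linarith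
  have h1 : ((1 - θ) * v) ^ 2 * l u v ^ 2 ≤ 25 * (a u v * b u v) :=
    le_trans (by gcongr) hsq
  have h2 : 25 * (a u v * b u v) ≤ 4 * (p * q) * ((1 - θ) * v) ^ 2 * (a u v * b u v) :=
    mul_le_mul_of_nonneg_right hpq (mul_nonneg ha hb)
  have h3 : l u v ^ 2 ≤ (p * a u v + q * b u v) ^ 2 := by
    have h4 : l u v ^ 2 ≤ 4 * (p * q) * (a u v * b u v) := by
      refine le_of_mul_le_mul_left ?_ (pow_pos hd 2)
      linarith
    nlinarith [sq_nonneg (p * a u v - q * b u v)]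
  exact le_of_abs_le (abs_le_of_sq_le_sq h3 (by positivity))

/-- Propagation of the outgoing flux density across a short range of `u`. -/
theorem flux_le (h : IsNullPotential w a b l) {u₀ u₁ v p q θ : ℝ} (hθ : θ < 1) (hu₀ : 0 < u₀)
    (hu : u₀ ≤ u₁) (huv : u₁ ≤ θ * v) (hv : 0 < v) (hp : 0 ≤ p) (hq : 0 ≤ q)
    (hpq : 25 ≤ 4 * (p * q) * ((1 - θ) * v) ^ 2) (hpu : p * (u₁ - u₀) ≤ 1) :
    a u₁ v ≤ 3 * (a u₀ v + q * (w u₀ v - w u₁ v)) := by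
  have hlt : ∀ x ≤ u₁, x < v := fun x hx => by nlinarith
  have key := le_of_hasDerivAt_nonpos
    (f := fun x => Real.exp (-(p * (x - u₀))) * a x v + q * w x v)
    (f' := fun x => (Real.exp (-(p * (x - u₀))) * (-p) * a x v
      + Real.exp (-(p * (x - u₀))) * l x v) + q * (-(b x v))) hu
    (fun x hx => by
      have hx0 : 0 < x := hu₀.trans_le hx.1
      have he : HasDerivAt (fun x => Real.exp (-(p * (x - u₀))))
          (Real.exp (-(p * (x - u₀))) * (-p)) x := by
        have := (((hasDerivAt_id x).sub_const u₀).const_mul p).neg.exp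
        simpa using this
      exact (he.mul (h.hasDerivAt_flux x v hx0 (hlt x hx.2))).add
        ((h.hasDerivAt_left x v hx0 (hlt x hx.2)).const_mul q))
    (fun x hx => by
      have hx0 : 0 < x := hu₀.trans_le hx.1
      have hl := h.mixed_le hθ hx0 (hx.2.trans huv) hv hp hq hpq
      have hb := h.left_nonneg x v hx0 (hlt x hx.2)
      have he0 := Real.exp_pos (-(p * (x - u₀)))
      have he1 : Real.exp (-(p * (x - u₀))) ≤ 1 := by
        rw [Real.exp_le_one_iff]
        have : 0 ≤ p * (x - u₀) := mul_nonneg hp (by linarith [hx.1])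
        linarith
      have h1 := mul_le_mul_of_nonneg_left hl he0.le
      have h2 := mul_le_mul_of_nonneg_right he1 (mul_nonneg hq hb)
      nlinarith)
  simp only [sub_self, mul_zero, neg_zero, Real.exp_zero, one_mul] at key
  have ha1 := h.right_nonneg u₁ v (hu₀.trans_le hu) (hlt u₁ le_rfl)
  have he : 1 ≤ 3 * Real.exp (-(p * (u₁ - u₀))) := by
    have h1 : Real.exp (-1) ≤ Real.exp (-(p * (u₁ - u₀))) := Real.exp_le_exp.2 (by linarith)
    have h2 : 1 ≤ 3 * Real.exp (-1) := by
      rw [Real.exp_neg, ← div_eq_mul_inv, le_div_iff₀ (Real.exp_pos 1)]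
      linarith [Real.exp_one_lt_d9]
    linarith
  nlinarith [mul_le_mul_of_nonneg_right he ha1]

/-- Propagation of the outgoing flux across a short range of `u`. -/
theorem step (h : IsNullPotential w a b l) {u₀ u₁ v₀ v₁ θ : ℝ} (hθ0 : 0 < θ) (hθ : θ < 1)
    (hu₀ : 0 < u₀) (hu : u₀ ≤ u₁) (huv : u₁ ≤ θ * v₀) (hv : v₀ ≤ v₁)
    (hstep : u₁ - u₀ ≤ (1 - θ) ^ 2 / 38 * v₀) :
    w u₁ v₁ - w u₁ v₀ ≤ 6 * (w u₀ v₁ - w u₀ v₀) + (w u₀ v₁ - w u₁ v₁) := by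
  have hv0 : 0 < v₀ := by
    by_contra hc
    nlinarith
  have hu1v : u₁ < v₀ := by nlinarith
  have hd : 0 < 1 - θ := by linarith
  set S := w u₀ v₁ - w u₁ v₀ with hS
  set c := (1 - θ) ^ 2 with hc
  have hc0 : 0 < c := by positivity
  have key := le_of_hasDerivAt_nonpos
    (f := fun y => w u₁ y - 3 * w u₀ y + S * v₀ / 2 * y⁻¹)
    (f' := fun y => a u₁ y - 3 * a u₀ y + S * v₀ / 2 * (-(y ^ 2)⁻¹)) hv
    (fun y hy => by
      have hy0 : 0 < y := hv0.trans_le hy.1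
      exact ((h.hasDerivAt_right u₁ y (hu₀.trans_le hu) (hu1v.trans_le hy.1)).sub
        ((h.hasDerivAt_right u₀ y hu₀ (hu.trans_lt (hu1v.trans_le hy.1))).const_mul 3)).add
        ((hasDerivAt_inv hy0.ne').const_mul _))
    (fun y hy => by
      have hy0 : 0 < y := hv0.trans_le hy.1
      have h1 := h.flux_le (u₀ := u₀) (u₁ := u₁) (v := y) (p := 75 / (2 * c * v₀))
        (q := v₀ / (6 * y ^ 2)) hθ hu₀ hu
        (huv.trans (mul_le_mul_of_nonneg_left hy.1 hθ0.le)) hy0 (by positivity) (by positivity)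
        (by
          rw [mul_pow, ← hc]
          field_simp
          norm_num)
        (by
          rw [div_mul_eq_mul_div, div_le_one (by positivity)]
          nlinarith [mul_pos hc0 hv0])
      have h2 : w u₀ y - w u₁ y ≤ S := by
        have e1 := h.mono_right hu₀ (hu.trans_lt (hu1v.trans_le hy.1)) hy.2
        have e2 := h.mono_right (hu₀.trans_le hu) hu1v hy.1
        linarith
      have h3 : v₀ / (6 * y ^ 2) * (w u₀ y - w u₁ y) ≤ v₀ / (6 * y ^ 2) * S :=
        mul_le_mul_of_nonneg_left h2 (by positivity)
      have h4 : v₀ / (6 * y ^ 2) * S * 3 = S * v₀ / 2 * (y ^ 2)⁻¹ := by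
        field_simp
        ring
      nlinarith)
  have hv1 : 0 < v₁ := hv0.trans_le hv
  have hS0 : 0 ≤ S := by
    have e1 := h.mono_right hu₀ (hu.trans_lt hu1v) hv
    have e2 := h.anti_left hu₀ hu hu1v
    linarith
  have e3 : S * v₀ / 2 * v₀⁻¹ = S / 2 := by field_simp
  have e4 : 0 ≤ S * v₀ / 2 * v₁⁻¹ := by positivity
  simp only [e3] at key
  linarith

theorem iterate (h : IsNullPotential w a b l) {A v₀ v₁ θ : ℝ} (hθ0 : 0 < θ) (hθ : θ < 1)
    (hA : 0 < A) (hv : v₀ ≤ v₁) (n : ℕ) :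
    ∀ u, A ≤ u → u ≤ θ * v₀ → u ≤ A + n * ((1 - θ) ^ 2 / 38 * v₀) →
      (w u v₁ - w u v₀) + (w u v₁ - w (θ * v₀) v₁) ≤
        6 ^ n * ((w A v₁ - w A v₀) + (w A v₁ - w (θ * v₀) v₁)) := by
  induction n with
  | zero =>
    intro u h1 h2 h3
    have : u = A := by
      apply le_antisymm _ h1
      simpa using h3
    simp [this]
  | succ n ih =>
    intro u h1 h2 h3
    have hv0 : 0 < v₀ := by
      by_contra hc
      nlinarith
    have hd : 0 < (1 - θ) ^ 2 / 38 * v₀ := by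
      have : 0 < 1 - θ := by linarith
      positivity
    set d := (1 - θ) ^ 2 / 38 * v₀ with hddef
    set u₀ := max A (u - d) with hu₀
    have hA' : A ≤ u₀ := le_max_left _ _
    have hle : u₀ ≤ u := max_le h1 (by linarith)
    have hcast : ((n + 1 : ℕ) : ℝ) * d = n * d + d := by push_cast; ring
    have ih' := ih u₀ hA' (hle.trans h2)
      (max_le (by have : (0 : ℝ) ≤ n * d := by positivity
                  linarith) (by linarith))
    have hst := h.step hθ0 hθ (hA.trans_le hA') hle h2 hv
      (by have := le_max_right A (u - d); linarith)
    have hθv : θ * v₀ < v₁ := by nlinarith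
    have e1 := h.mono_right (hA.trans_le hA') (by nlinarith : u₀ < v₀) hv
    have e2 := h.anti_left (hA.trans_le hA') (hle.trans h2) hθv
    rw [pow_succ]
    linarith

/-- The outgoing flux through null rays starting in `A ≤ u ≤ θ v` tends to zero as `v → ∞`. -/
theorem flux_tendsto_zero (h : IsNullPotential w a b l) {m M θ : ℝ} (hθ0 : 0 < θ) (hθ : θ < 1)
    (hm : ∀ u v, 0 < u → u < v → m ≤ w u v) (hM : ∀ u v, 0 < u → u < v → w u v ≤ M) {ε : ℝ}
    (hε : 0 < ε) :
    ∃ A V, 0 < A ∧ ∀ v, V ≤ v → ∀ u, A ≤ u → u ≤ θ * v → ∀ v', v ≤ v' →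
      w u v' - w u v ≤ ε := by
  obtain ⟨n, hn⟩ := exists_nat_ge (38 * θ / (1 - θ) ^ 2)
  have hd : 0 < (1 - θ) ^ 2 := by
    have : 0 < 1 - θ := by linarith
    positivity
  obtain ⟨η, hη, hηε⟩ : ∃ η : ℝ, 0 < η ∧ 6 ^ n * (4 * η) ≤ ε := by
    refine ⟨ε / (6 ^ n * 4), by positivity, le_of_eq ?_⟩
    field_simp
  let g : ℝ → Set ℝ := fun u => (fun v => w u v) '' Ioi u
  have hgne : ∀ u, (g u).Nonempty := fun u => ⟨_, u + 1, by simp, rfl⟩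
  have hgb : ∀ u, 0 < u → BddAbove (g u) := by
    rintro u hu
    refine ⟨M, ?_⟩
    rintro _ ⟨v, hv, rfl⟩
    exact hM u v hu hv
  have hle : ∀ u v, 0 < u → u < v → w u v ≤ sSup (g u) := fun u v hu hv =>
    le_csSup (hgb u hu) ⟨v, hv, rfl⟩
  let H : Set ℝ := (fun u => sSup (g u)) '' Ioi 0
  have hHb : BddBelow H := by
    refine ⟨m, ?_⟩
    rintro _ ⟨u, hu, rfl⟩
    exact (hm u (u + 1) hu (by simp)).trans (hle u (u + 1) hu (by simp))
  have hHne : H.Nonempty := ⟨_, 1, by simp, rfl⟩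
  obtain ⟨_, ⟨A, hA, rfl⟩, hAlt⟩ := exists_lt_of_csInf_lt hHne (lt_add_of_pos_right (sInf H) hη)
  have hA : 0 < A := hA
  obtain ⟨_, ⟨V, hV, rfl⟩, hVlt⟩ := exists_lt_of_lt_csSup (hgne A)
    (sub_lt_self (sSup (g A)) hη)
  have hV : A < V := hV
  refine ⟨A, V, hA, fun v hv u hAu huv v' hv' => ?_⟩
  have hv0 : 0 < v := by linarith
  have hθv : 0 < θ * v := by positivity
  obtain ⟨_, ⟨v₂, hv₂, rfl⟩, hv₂lt⟩ := exists_lt_of_lt_csSup (hgne (θ * v))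
    (sub_lt_self (sSup (g (θ * v))) hη)
  have hv₂ : θ * v < v₂ := hv₂
  have hinf : sInf H ≤ sSup (g (θ * v)) := csInf_le hHb ⟨_, hθv, rfl⟩
  set v₁ := max v' v₂ with hv₁
  have hvv₁ : v ≤ v₁ := hv'.trans (le_max_left _ _)
  have it := h.iterate hθ0 hθ hA hvv₁ n u hAu huv (by
    rw [div_le_iff₀ hd] at hn
    have := mul_le_mul_of_nonneg_right hn hv0.le
    linarith)
  have b1 : w A v₁ ≤ sSup (g A) := hle A v₁ hA (by linarith)
  have b2 := h.mono_right hA hV hv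
  have b3 := h.mono_right hθv hv₂ (le_max_right v' v₂)
  have huv' : u < v := by nlinarith
  have b4 := h.mono_right (hA.trans_le hAu) (huv'.trans_le hv') (le_max_left v' v₂)
  have b5 := h.anti_left (hA.trans_le hAu) huv (by nlinarith : θ * v < v₁)
  have b6 : (w A v₁ - w A v) + (w A v₁ - w (θ * v) v₁) ≤ 4 * η := by
    simp only at hVlt hv₂lt hAlt
    linarith
  have b7 := mul_le_mul_of_nonneg_left b6 (by positivity : (0 : ℝ) ≤ 6 ^ n)
  linarith

end IsNullPotential

/-- The momentum density `2 r ∂ₜψ ∂ᵣψ`. -/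
def momDen (ψ : ℝ → ℝ → ℝ) (t r : ℝ) : ℝ := 2 * r * (pT ψ t r * pR ψ t r)

/-- The continuous linear form `x dt + y dr`. -/
def form (x y : ℝ) : ℝ × ℝ →L[ℝ] ℝ :=
  x • ContinuousLinearMap.fst ℝ ℝ ℝ + y • ContinuousLinearMap.snd ℝ ℝ ℝ

@[simp]
theorem form_apply (x y : ℝ) (p : ℝ × ℝ) : form x y p = x * p.1 + y * p.2 := by
  simp [form]

theorem eq_form (D : ℝ × ℝ →L[ℝ] ℝ) : D = form (D (1, 0)) (D (0, 1)) := by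
  ext <;> simp

theorem HasFDerivAt.hasDerivAt_line {f : ℝ × ℝ → ℝ} {x y : ℝ} {c : ℝ → ℝ × ℝ} {s : ℝ}
    {c' : ℝ × ℝ} (hf : HasFDerivAt f (form x y) (c s)) (hc : HasDerivAt c c' s) :
    HasDerivAt (fun s => f (c s)) (x * c'.1 + y * c'.2) s := by
  exact (hf.comp_hasDerivAt s hc).congr_deriv (by simp)

theorem hasDerivAt_time (t r : ℝ) : HasDerivAt (fun s => (s, r)) ((1, 0) : ℝ × ℝ) t :=
  (hasDerivAt_id t).prodMk (hasDerivAt_const t r)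

theorem hasDerivAt_radius (t r : ℝ) : HasDerivAt (fun ρ => (t, ρ)) ((0, 1) : ℝ × ℝ) r :=
  (hasDerivAt_const r t).prodMk (hasDerivAt_id r)

/-- The open quadrant of positive times and radii. -/
def quadrant : Set (ℝ × ℝ) := Ioi 0 ×ˢ Ioi 0

theorem isOpen_quadrant : IsOpen quadrant := isOpen_Ioi.prod isOpen_Ioi

namespace IsWaveMap

variable {ψ : ℝ → ℝ → ℝ}

theorem contDiffAt (h : IsWaveMap ψ) {p : ℝ × ℝ} (hp : p ∈ quadrant) :
    ContDiffAt ℝ (⊤ : ℕ∞) (fun p : ℝ × ℝ => ψ p.1 p.2) p :=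
  (h.1.mono (prod_mono Ioi_subset_Ici_self subset_rfl)).contDiffAt (isOpen_quadrant.mem_nhds hp)

theorem hasFDerivAt (h : IsWaveMap ψ) {p : ℝ × ℝ} (hp : p ∈ quadrant) :
    HasFDerivAt (fun p : ℝ × ℝ => ψ p.1 p.2) (form (pT ψ p.1 p.2) (pR ψ p.1 p.2)) p := by
  have hd := ((h.contDiffAt hp).differentiableAt (by simp)).hasFDerivAt
  rw [eq_form (fderiv ℝ _ p)] at hd
  have h1 : pT ψ p.1 p.2 = fderiv ℝ (fun p : ℝ × ℝ => ψ p.1 p.2) p (1, 0) := by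
    have := (HasFDerivAt.hasDerivAt_line (c := fun s => (s, p.2)) (s := p.1) hd
      (hasDerivAt_time p.1 p.2)).deriv
    simpa [pT] using this
  have h2 : pR ψ p.1 p.2 = fderiv ℝ (fun p : ℝ × ℝ => ψ p.1 p.2) p (0, 1) := by
    have := (HasFDerivAt.hasDerivAt_line (c := fun s => (p.1, s)) (s := p.2) hd
      (hasDerivAt_radius p.1 p.2)).deriv
    simpa [pR] using this
  rwa [h1, h2]

theorem exists_second_partials (h : IsWaveMap ψ) {p : ℝ × ℝ} (hp : p ∈ quadrant) :
    ∃ x y z, HasFDerivAt (fun q : ℝ × ℝ => pT ψ q.1 q.2) (form x y) p ∧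
      HasFDerivAt (fun q : ℝ × ℝ => pR ψ q.1 q.2) (form y z) p ∧
      x - z - (1 / p.2) * pR ψ p.1 p.2 + Real.sin (2 * ψ p.1 p.2) / (2 * p.2 ^ 2) = 0 := by
  set f : ℝ × ℝ → ℝ := fun p => ψ p.1 p.2 with hf
  have hd2 : HasFDerivAt (fderiv ℝ f) (fderiv ℝ (fderiv ℝ f) p) p :=
    (((h.contDiffAt hp).fderiv_right (m := 1) (by norm_cast)).differentiableAt
      (by simp)).hasFDerivAt
  have hsymm : IsSymmSndFDerivAt ℝ f p :=
    (h.contDiffAt hp).isSymmSndFDerivAt (by simp; norm_cast)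
  have hev : ∀ᶠ q in nhds p, fderiv ℝ f q = form (pT ψ q.1 q.2) (pR ψ q.1 q.2) := by
    filter_upwards [isOpen_quadrant.mem_nhds hp] with q hq
    exact (h.hasFDerivAt hq).fderiv
  have hA : HasFDerivAt (fun q : ℝ × ℝ => pT ψ q.1 q.2)
      ((fderiv ℝ (fderiv ℝ f) p).flip (1, 0)) p := by
    have := hd2.clm_apply (hasFDerivAt_const ((1, 0) : ℝ × ℝ) p)
    simp only [ContinuousLinearMap.comp_zero, zero_add] at this
    refine this.congr_of_eventuallyEq ?_
    filter_upwards [hev] with q hq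
    simp [hq]
  have hB : HasFDerivAt (fun q : ℝ × ℝ => pR ψ q.1 q.2)
      ((fderiv ℝ (fderiv ℝ f) p).flip (0, 1)) p := by
    have := hd2.clm_apply (hasFDerivAt_const ((0, 1) : ℝ × ℝ) p)
    simp only [ContinuousLinearMap.comp_zero, zero_add] at this
    refine this.congr_of_eventuallyEq ?_
    filter_upwards [hev] with q hq
    simp [hq]
  rw [eq_form ((fderiv ℝ (fderiv ℝ f) p).flip _)] at hA hB
  simp only [ContinuousLinearMap.flip_apply] at hA hB
  rw [hsymm (1, 0) (0, 1)] at hB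
  refine ⟨_, _, _, hA, hB, ?_⟩
  have e1 := (HasFDerivAt.hasDerivAt_line (c := fun s => (s, p.2)) (s := p.1) hA
      (hasDerivAt_time p.1 p.2)).deriv
  have e2 := (HasFDerivAt.hasDerivAt_line (c := fun s => (p.1, s)) (s := p.2) hB
      (hasDerivAt_radius p.1 p.2)).deriv
  have e3 := h.2 p.1 p.2 (le_of_lt hp.1) hp.2
  simp only [mul_one, mul_zero, add_zero, zero_add] at e1 e2
  rw [e1, e2] at e3
  exact e3

theorem exists_density_partials (h : IsWaveMap ψ) {p : ℝ × ℝ} (hp : p ∈ quadrant) :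
    ∃ x y z, HasFDerivAt (fun q : ℝ × ℝ => eDen ψ q.1 q.2) (form x y) p ∧
      HasFDerivAt (fun q : ℝ × ℝ => momDen ψ q.1 q.2) (form z x) p ∧
      p.2 ^ 2 * (z - y) ^ 2 ≤ 24 * (eDen ψ p.1 p.2 ^ 2 - momDen ψ p.1 p.2 ^ 2) := by
  obtain ⟨x, y, z, hA, hB, hw⟩ := h.exists_second_partials hp
  have hψ := h.hasFDerivAt hp
  have hr : 0 < p.2 := hp.2
  have hsnd : HasFDerivAt (fun q : ℝ × ℝ => q.2) (form 0 1) p := by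
    have : form 0 1 = ContinuousLinearMap.snd ℝ ℝ ℝ := by ext <;> simp
    rw [this]
    exact hasFDerivAt_snd
  set A := pT ψ p.1 p.2 with hAdef
  set B := pR ψ p.1 p.2 with hBdef
  set s := Real.sin (ψ p.1 p.2) with hs
  set c := Real.cos (ψ p.1 p.2) with hc
  set r := p.2 with hrdef
  have hw' : x = z + B / r - s * c / r ^ 2 := by
    rw [Real.sin_two_mul] at hw
    field_simp at hw ⊢
    linarith
  have hP : HasFDerivAt (fun q : ℝ × ℝ => eDen ψ q.1 q.2)
      (form (r * (2 * A * x + 2 * B * y) + 2 * s * c * A / r)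
        (A ^ 2 + B ^ 2 - s ^ 2 / r ^ 2 + r * (2 * A * y + 2 * B * z) + 2 * s * c * B / r)) p := by
    have hinv : HasFDerivAt (fun q : ℝ × ℝ => (q.2)⁻¹) (-(r ^ 2)⁻¹ • form 0 1) p :=
      (hasDerivAt_inv hr.ne').comp_hasFDerivAt p hsnd
    have := (((hA.pow 2).add (hB.pow 2)).add ((hψ.sin.mul hinv).pow 2)).mul hsnd
    refine (this.congr_fderiv ?_).congr_of_eventuallyEq ?_
    · ext <;> simp [← hs, ← hc, ← hAdef, ← hBdef, ← hrdef] <;> field_simp <;> ring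
    · filter_upwards with q
      simp [eDen, mul_pow, div_eq_mul_inv]
  have hM : HasFDerivAt (fun q : ℝ × ℝ => momDen ψ q.1 q.2)
      (form (2 * r * (x * B + A * y)) (2 * A * B + 2 * r * (y * B + A * z))) p := by
    have := (hsnd.const_mul 2).mul (hA.mul hB)
    refine this.congr_fderiv ?_
    ext <;> simp [← hAdef, ← hBdef, ← hrdef] <;> ring
  refine ⟨_, _, 2 * r * (x * B + A * y), hP, ?_, ?_⟩
  · convert hM using 2
    rw [hw']
    field_simp
    ring
  · have e1 : 2 * r * (x * B + A * y) - (A ^ 2 + B ^ 2 - s ^ 2 / r ^ 2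
        + r * (2 * A * y + 2 * B * z) + 2 * s * c * B / r)
        = B ^ 2 - A ^ 2 + s ^ 2 / r ^ 2 - 4 * (s * c * B / r) := by
      rw [hw']
      field_simp
      ring
    rw [e1]
    have hc1 : c ^ 2 ≤ 1 := by
      have := Real.sin_sq_add_cos_sq (ψ p.1 p.2)
      nlinarith [sq_nonneg s]
    obtain ⟨σ, hσ⟩ : ∃ σ, σ = s / r := ⟨_, rfl⟩
    have e2 : s ^ 2 / r ^ 2 = σ ^ 2 := by rw [hσ, div_pow]
    have e3 : s * c * B / r = σ * c * B := by rw [hσ]; ring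
    have e4 : eDen ψ p.1 p.2 = (A ^ 2 + B ^ 2 + σ ^ 2) * r := by
      rw [← e2]; rfl
    have e5 : momDen ψ p.1 p.2 = 2 * r * (A * B) := rfl
    rw [e2, e3, e4, e5]
    have e6 : (B ^ 2 - A ^ 2 + σ ^ 2 - 4 * (σ * c * B)) ^ 2 ≤
        24 * ((A ^ 2 + B ^ 2 + σ ^ 2) ^ 2 - (2 * (A * B)) ^ 2) := by
      have f1 : (σ * c * B) ^ 2 ≤ σ ^ 2 * B ^ 2 := by
        have := mul_le_mul_of_nonneg_right hc1 (mul_nonneg (sq_nonneg σ) (sq_nonneg B))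
        nlinarith
      nlinarith [sq_nonneg (B ^ 2 - A ^ 2 - σ ^ 2), sq_nonneg (B ^ 2 - A ^ 2 + 4 * (σ * c * B)),
        sq_nonneg (σ ^ 2 + 4 * (σ * c * B)), sq_nonneg (σ * A), sq_nonneg (σ * B),
        sq_nonneg (B ^ 2 - A ^ 2), sq_nonneg (σ ^ 2)]
    have := mul_le_mul_of_nonneg_left e6 (sq_nonneg r)
    linarith

/-- Local energy conservation: the energy-momentum form has a potential. -/
theorem exists_potential (h : IsWaveMap ψ) :
    ∃ W : ℝ × ℝ → ℝ, ∀ p ∈ quadrant,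
      HasFDerivAt W (form (momDen ψ p.1 p.2) (eDen ψ p.1 p.2)) p := by
  have hω : ∀ p ∈ quadrant, ∃ D : ℝ × ℝ →L[ℝ] ℝ × ℝ →L[ℝ] ℝ,
      HasFDerivAt (fun p : ℝ × ℝ => form (momDen ψ p.1 p.2) (eDen ψ p.1 p.2)) D p ∧
      ∀ x y, D x y = D y x := by
    intro p hp
    obtain ⟨x, y, z, hP, hM, -⟩ := h.exists_density_partials hp
    refine ⟨_, (hM.smul_const (ContinuousLinearMap.fst ℝ ℝ ℝ)).add
      (hP.smul_const (ContinuousLinearMap.snd ℝ ℝ ℝ)), fun v w => ?_⟩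
    simp
    ring
  refine Convex.exists_forall_hasFDerivAt_of_fderiv_symmetric
    ((convex_Ioi 0).prod (convex_Ioi 0)) isOpen_quadrant ?_ ?_
  · intro p hp
    obtain ⟨D, hD, -⟩ := hω p hp
    exact hD.differentiableAt.differentiableWithinAt
  · intro p hp
    obtain ⟨D, hD, hs⟩ := hω p hp
    rw [hD.fderiv]
    exact hs

end IsWaveMap

theorem eDen_nonneg (ψ : ℝ → ℝ → ℝ) (t : ℝ) {r : ℝ} (hr : 0 ≤ r) : 0 ≤ eDen ψ t r := by
  unfold eDen
  positivity

theorem abs_momDen_le (ψ : ℝ → ℝ → ℝ) (t : ℝ) {r : ℝ} (hr : 0 ≤ r) :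
    |momDen ψ t r| ≤ eDen ψ t r := by
  have h : 0 ≤ Real.sin (ψ t r) ^ 2 / r ^ 2 * r := by positivity
  unfold momDen eDen
  rw [abs_le]
  constructor
  · nlinarith [mul_nonneg hr (sq_nonneg (pT ψ t r + pR ψ t r))]
  · nlinarith [mul_nonneg hr (sq_nonneg (pT ψ t r - pR ψ t r))]

/-- `W` is a potential of the energy-momentum form of `ψ`, normalized to vanish at infinity. -/
structure IsEnergyPotential (ψ : ℝ → ℝ → ℝ) (W : ℝ × ℝ → ℝ) : Prop where
  hasFDerivAt : ∀ p ∈ quadrant, HasFDerivAt W (form (momDen ψ p.1 p.2) (eDen ψ p.1 p.2)) p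
  nonpos : ∀ p ∈ quadrant, W p ≤ 0
  neg_energy_le : ∀ p ∈ quadrant, -totE ψ 0 ≤ W p
  tendsto : ∀ t, 0 < t → Tendsto (fun r => W (t, r)) atTop (nhds 0)

theorem hasDerivAt_outgoing (t r s : ℝ) :
    HasDerivAt (fun s => (t + s, r + s)) ((1, 1) : ℝ × ℝ) s :=
  ((hasDerivAt_id s).const_add t).prodMk ((hasDerivAt_id s).const_add r)

theorem hasDerivAt_incoming (t r s : ℝ) :
    HasDerivAt (fun s => (t - s, r + s)) ((-1, 1) : ℝ × ℝ) s :=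
  ((hasDerivAt_id s).const_sub t).prodMk ((hasDerivAt_id s).const_add r)

section Potential

variable {ψ : ℝ → ℝ → ℝ} {W : ℝ × ℝ → ℝ}

theorem potential_le_outgoing
    (hW : ∀ p ∈ quadrant, HasFDerivAt W (form (momDen ψ p.1 p.2) (eDen ψ p.1 p.2)) p)
    {t r s : ℝ} (ht : 0 < t) (hr : 0 < r) (hs : 0 ≤ s) : W (t, r) ≤ W (t + s, r + s) := by
  have := le_of_hasDerivAt_nonpos (f := fun s => -W (t + s, r + s)) hs
    (fun x hx => (HasFDerivAt.hasDerivAt_line (c := fun s => (t + s, r + s)) (s := x) (hW (t + x, r + x)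
      ⟨add_pos_of_pos_of_nonneg ht hx.1, add_pos_of_pos_of_nonneg hr hx.1⟩)
      (hasDerivAt_outgoing t r x)).neg)
    (fun x hx => by
      have := (abs_le.1 (abs_momDen_le ψ (t + x) (add_nonneg hr.le hx.1))).1
      linarith)
  simpa using this

theorem potential_le_incoming
    (hW : ∀ p ∈ quadrant, HasFDerivAt W (form (momDen ψ p.1 p.2) (eDen ψ p.1 p.2)) p)
    {t r s : ℝ} (hr : 0 < r) (hs : 0 ≤ s) (hst : s < t) : W (t, r) ≤ W (t - s, r + s) := by
  have := le_of_hasDerivAt_nonpos (f := fun s => -W (t - s, r + s)) hs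
    (fun x hx => (HasFDerivAt.hasDerivAt_line (c := fun s => (t - s, r + s)) (s := x) (hW (t - x, r + x)
      ⟨sub_pos.2 (hx.2.trans_lt hst), add_pos_of_pos_of_nonneg hr hx.1⟩)
      (hasDerivAt_incoming t r x)).neg)
    (fun x hx => by
      have := (abs_le.1 (abs_momDen_le ψ (t - x) (add_nonneg hr.le hx.1))).2
      linarith)
  simpa using this

theorem hasDerivAt_potential_radius
    (hW : ∀ p ∈ quadrant, HasFDerivAt W (form (momDen ψ p.1 p.2) (eDen ψ p.1 p.2)) p)
    {t r : ℝ} (ht : 0 < t) (hr : 0 < r) : HasDerivAt (fun r => W (t, r)) (eDen ψ t r) r := by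
  simpa using HasFDerivAt.hasDerivAt_line (c := fun r => (t, r)) (hW (t, r) ⟨ht, hr⟩) (hasDerivAt_radius t r)

theorem potential_sub_eq_integral
    (hW : ∀ p ∈ quadrant, HasFDerivAt W (form (momDen ψ p.1 p.2) (eDen ψ p.1 p.2)) p)
    (hfe : FiniteEnergy ψ) {t r₁ r₂ : ℝ} (ht : 0 < t) (h₁ : 0 < r₁) (h : r₁ ≤ r₂) :
    ∫ r in r₁..r₂, eDen ψ t r = W (t, r₂) - W (t, r₁) := by
  refine intervalIntegral.integral_eq_sub_of_hasDerivAt (f := fun r => W (t, r)) ?_ ?_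
  · intro r hr
    rw [uIcc_of_le h] at hr
    exact hasDerivAt_potential_radius hW ht (h₁.trans_le hr.1)
  · rw [intervalIntegrable_iff_integrableOn_Ioc_of_le h]
    exact (hfe t ht.le).mono_set fun r hr => h₁.trans hr.1

end Potential

theorem exists_isEnergyPotential {ψ : ℝ → ℝ → ℝ} (hwm : IsWaveMap ψ) (hfe : FiniteEnergy ψ)
    (hcons : EnergyConserved ψ) : ∃ W, IsEnergyPotential ψ W := by
  obtain ⟨W, hW⟩ := hwm.exists_potential
  have hlim : ∀ t, 0 < t → ∃ L, Tendsto (fun r => W (t, r)) atTop (nhds L) := by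
    intro t ht
    have h1 : IntegrableOn (eDen ψ t) (Ioi 1) :=
      (hfe t ht.le).mono_set (Ioi_subset_Ioi zero_le_one)
    have h2 := (intervalIntegral_tendsto_integral_Ioi 1 h1 tendsto_id).const_add (W (t, 1))
    refine ⟨_, h2.congr' ?_⟩
    filter_upwards [eventually_ge_atTop 1] with r hr
    simp only [id]
    rw [potential_sub_eq_integral hW hfe ht one_pos hr]
    ring
  choose! L hL using hlim
  have hconst : ∀ t₁ t₂, 0 < t₁ → t₁ ≤ t₂ → L t₁ = L t₂ := by
    intro t₁ t₂ h1 h12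
    have hsh : Tendsto (fun r : ℝ => r + (t₂ - t₁)) atTop atTop :=
      tendsto_atTop_add_const_right _ _ tendsto_id
    apply le_antisymm
    · refine le_of_tendsto_of_tendsto (hL t₁ h1) ((hL t₂ (h1.trans_le h12)).comp hsh) ?_
      filter_upwards [eventually_gt_atTop 0] with r hr
      have := potential_le_outgoing hW h1 hr (sub_nonneg.2 h12)
      simpa using this
    · refine le_of_tendsto_of_tendsto (hL t₂ (h1.trans_le h12)) ((hL t₁ h1).comp hsh) ?_
      filter_upwards [eventually_gt_atTop 0] with r hr
      have := potential_le_incoming hW hr (sub_nonneg.2 h12) (t := t₂) (by linarith)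
      simpa using this
  have hL1 : ∀ t, 0 < t → Tendsto (fun r => W (t, r)) atTop (nhds (L 1)) := by
    intro t ht
    have : L t = L 1 := by
      rcases le_total t 1 with h | h
      · exact hconst t 1 ht h
      · exact (hconst 1 t one_pos h).symm
    exact this ▸ hL t ht
  have hmono : ∀ t r₁ r₂, 0 < t → 0 < r₁ → r₁ ≤ r₂ → W (t, r₁) ≤ W (t, r₂) := by
    intro t r₁ r₂ ht h1 h12
    have := intervalIntegral.integral_nonneg (μ := volume) h12
      (fun r hr => eDen_nonneg ψ t (h1.le.trans hr.1))
    rw [potential_sub_eq_integral hW hfe ht h1 h12] at this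
    linarith
  refine ⟨fun p => W p - L 1, ⟨fun p hp => (hW p hp).sub_const _, ?_, ?_, ?_⟩⟩
  · rintro ⟨t, r⟩ ⟨ht, hr⟩
    refine sub_nonpos.2 (ge_of_tendsto (hL1 t ht) ?_)
    filter_upwards [eventually_ge_atTop r] with ρ hρ
    exact hmono t r ρ ht hr hρ
  · rintro ⟨t, r⟩ ⟨ht, hr⟩
    have : L 1 ≤ W (t, r) + totE ψ 0 := by
      refine le_of_tendsto (hL1 t ht) ?_
      filter_upwards [eventually_ge_atTop r] with ρ hρ
      have h1 := potential_sub_eq_integral hW hfe ht hr hρ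
      rw [intervalIntegral.integral_of_le hρ] at h1
      have h2 : ∫ x in Ioc r ρ, eDen ψ t x ≤ totE ψ t := by
        refine setIntegral_mono_set (hfe t (le_of_lt ht)) ?_
          (LE.le.eventuallyLE fun x hx => lt_trans hr hx.1)
        filter_upwards [ae_restrict_mem measurableSet_Ioi] with x hx
        exact eDen_nonneg ψ t (le_of_lt hx)
      rw [hcons t (le_of_lt ht)] at h2
      linarith
    linarith
  · intro t ht
    simpa using (hL1 t ht).sub_const (L 1)

theorem IsEnergyPotential.exists_isNullPotential {ψ : ℝ → ℝ → ℝ} {W : ℝ × ℝ → ℝ}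
    (hW : IsEnergyPotential ψ W) (hwm : IsWaveMap ψ) :
    ∃ a b l, IsNullPotential (fun u v => W ((u + v) / 2, (v - u) / 2)) a b l := by
  have hq : ∀ u v : ℝ, 0 < u → u < v → ((u + v) / 2, (v - u) / 2) ∈ quadrant :=
    fun u v hu huv => ⟨mem_Ioi.2 (by linarith), mem_Ioi.2 (by linarith)⟩
  have hv : ∀ u v : ℝ, HasDerivAt (fun y => ((u + y) / 2, (y - u) / 2))
      ((1 / 2, 1 / 2) : ℝ × ℝ) v := fun u v =>
    (((hasDerivAt_id v).const_add u).div_const 2).prodMk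
      (((hasDerivAt_id v).sub_const u).div_const 2)
  have hu : ∀ u v : ℝ, HasDerivAt (fun x => ((x + v) / 2, (v - x) / 2))
      ((1 / 2, -1 / 2) : ℝ × ℝ) u := fun u v =>
    (((hasDerivAt_id u).add_const v).div_const 2).prodMk
      (((hasDerivAt_id u).const_sub v).div_const 2)
  let P : ℝ → ℝ → ℝ := fun u v => eDen ψ ((u + v) / 2) ((v - u) / 2)
  let M : ℝ → ℝ → ℝ := fun u v => momDen ψ ((u + v) / 2) ((v - u) / 2)
  have hl : ∀ u v, 0 < u → u < v → ∃ l, HasDerivAt (fun x => (M x v + P x v) / 2) l u ∧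
      (v - u) ^ 2 * l ^ 2 ≤ 25 * ((M u v + P u v) / 2 * ((P u v - M u v) / 2)) := by
    intro u v h0 huv
    obtain ⟨x, y, z, hP, hM, hle⟩ := hwm.exists_density_partials (hq u v h0 huv)
    refine ⟨_, ((HasFDerivAt.hasDerivAt_line (c := fun x => ((x + v) / 2, (v - x) / 2)) (s := u)
      hM (hu u v)).add
      (HasFDerivAt.hasDerivAt_line (c := fun x => ((x + v) / 2, (v - x) / 2)) (s := u)
      hP (hu u v))).div_const 2, ?_⟩
    change _ ≤ 24 * (P u v ^ 2 - M u v ^ 2) at hle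
    simp only at hle ⊢
    have := mul_nonneg (sq_nonneg ((v - u) / 2)) (sq_nonneg (z - y))
    nlinarith
  choose! l hl using hl
  have hMP : ∀ u v, 0 < u → u < v → |M u v| ≤ P u v := fun u v h0 huv =>
    abs_momDen_le ψ _ (by linarith)
  refine ⟨fun u v => (M u v + P u v) / 2, fun u v => (P u v - M u v) / 2, l,
    fun u v h0 huv => ?_, fun u v h0 huv => ?_, fun u v h0 huv => (hl u v h0 huv).1,
    fun u v h0 huv => ?_, fun u v h0 huv => ?_, fun u v h0 huv => (hl u v h0 huv).2⟩
  · refine (HasFDerivAt.hasDerivAt_line (c := fun y => ((u + y) / 2, (y - u) / 2)) (s := v)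
      (hW.hasFDerivAt _ (hq u v h0 huv)) (hv u v)).congr_deriv ?_
    simp only [P, M]
    ring
  · refine (HasFDerivAt.hasDerivAt_line (c := fun x => ((x + v) / 2, (v - x) / 2)) (s := u)
      (hW.hasFDerivAt _ (hq u v h0 huv)) (hu u v)).congr_deriv ?_
    simp only [P, M]
    ring
  · have := (abs_le.1 (hMP u v h0 huv)).1
    linarith
  · have := (abs_le.1 (hMP u v h0 huv)).2
    linarith

/-- The primitive of `sin²` vanishing at the origin. -/
def sinSqPrimitive (x : ℝ) : ℝ := x / 2 - Real.sin (2 * x) / 4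

theorem hasDerivAt_sinSqPrimitive (x : ℝ) :
    HasDerivAt sinSqPrimitive (Real.sin x ^ 2) x := by
  have h := ((hasDerivAt_id x).div_const 2).sub
    ((((hasDerivAt_id x).const_mul 2).sin).div_const 4)
  refine h.congr_deriv ?_
  simp only [id, mul_one]
  rw [Real.cos_two_mul, Real.cos_sq']
  ring

theorem monotone_sinSqPrimitive : Monotone sinSqPrimitive := by
  refine monotone_of_deriv_nonneg
    (fun x => (hasDerivAt_sinSqPrimitive x).differentiableAt) fun x => ?_
  rw [(hasDerivAt_sinSqPrimitive x).deriv]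
  positivity

theorem exists_abs_lt_of_abs_sinSqPrimitive_le {ε : ℝ} (hε : 0 < ε) :
    ∃ δ > 0, ∀ x, |sinSqPrimitive x| ≤ δ → |x| < ε := by
  have hpos : 0 < sinSqPrimitive ε := by
    have := Real.sin_lt (by linarith : 0 < 2 * ε)
    unfold sinSqPrimitive
    linarith
  have hodd : sinSqPrimitive (-ε) = -sinSqPrimitive ε := by
    unfold sinSqPrimitive
    rw [mul_neg, Real.sin_neg]
    ring
  refine ⟨sinSqPrimitive ε / 2, by positivity, fun x hx => ?_⟩
  rw [abs_le] at hx
  by_contra hc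
  rcases le_abs.1 (not_lt.1 hc) with h | h
  · linarith [monotone_sinSqPrimitive h]
  · linarith [monotone_sinSqPrimitive (by linarith : x ≤ -ε)]

theorem abs_sub_le_of_abs_hasDerivAt_le {f f' g g' : ℝ → ℝ} {a b : ℝ} (hab : a ≤ b)
    (hf : ∀ x ∈ Icc a b, HasDerivAt f (f' x) x) (hg : ∀ x ∈ Icc a b, HasDerivAt g (g' x) x)
    (hle : ∀ x ∈ Icc a b, |f' x| ≤ g' x) : |f b - f a| ≤ g b - g a := by
  have h1 := le_of_hasDerivAt_nonpos (f := fun x => f x - g x) hab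
    (fun x hx => (hf x hx).sub (hg x hx))
    (fun x hx => by have := (abs_le.1 (hle x hx)).2; linarith)
  have h2 := le_of_hasDerivAt_nonpos (f := fun x => -f x - g x) hab
    (fun x hx => (hf x hx).neg.sub (hg x hx))
    (fun x hx => by have := (abs_le.1 (hle x hx)).1; linarith)
  rw [abs_le]
  constructor <;> linarith

/-- If `f` converges to a multiple of `π` along a ray, its distance to the limit is controlled by
the total flux along the ray. -/
theorem abs_sinSqPrimitive_le_of_tendsto {f f' g g' : ℝ → ℝ} {a η : ℝ} (k : ℤ)
    (hf : ∀ x, a ≤ x → HasDerivAt f (f' x) x) (hg : ∀ x, a ≤ x → HasDerivAt g (g' x) x)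
    (hle : ∀ x, a ≤ x → |Real.sin (f x) ^ 2 * f' x| ≤ g' x) (hη : ∀ x, a ≤ x → g x - g a ≤ η)
    (hlim : Tendsto f atTop (nhds (k * Real.pi))) :
    |sinSqPrimitive (f a - k * Real.pi)| ≤ η := by
  have hsin : ∀ x : ℝ, Real.sin (x - k * Real.pi) ^ 2 = Real.sin x ^ 2 := by
    intro x
    rw [Real.sin_sq, Real.sin_sq, Real.cos_sub_int_mul_pi, mul_pow]
    have : ((-1 : ℝ) ^ k) ^ 2 = 1 := by
      rw [← zpow_natCast, zpow_comm]
      simp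
    rw [this, one_mul]
  have h1 : Tendsto (fun x => |sinSqPrimitive (f x - k * Real.pi)
      - sinSqPrimitive (f a - k * Real.pi)|) atTop
      (nhds |sinSqPrimitive (k * Real.pi - k * Real.pi)
        - sinSqPrimitive (f a - k * Real.pi)|) :=
    ((((hasDerivAt_sinSqPrimitive _).continuousAt.tendsto).comp (hlim.sub_const _)).sub_const
      _).abs
  have h2 : sinSqPrimitive (k * Real.pi - k * Real.pi) = 0 := by simp [sinSqPrimitive]
  rw [h2, zero_sub, abs_neg] at h1
  refine le_of_tendsto h1 ?_
  filter_upwards [eventually_ge_atTop a] with x hx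
  refine (abs_sub_le_of_abs_hasDerivAt_le
    (f := fun x => sinSqPrimitive (f x - k * Real.pi)) hx
    (fun y hy => (hasDerivAt_sinSqPrimitive _).comp y ((hf y hy.1).sub_const _))
    (fun y hy => hg y hy.1) (fun y hy => ?_)).trans (hη x hx)
  rw [hsin]
  exact hle y hy.1

/-- The nonlinear potential is controlled by the energy in the direction of a characteristic. -/
theorem abs_sin_sq_mul_le {s x r : ℝ} (hs : |s| ≤ 1) (hr : 0 < r) :
    |s ^ 2 * x| ≤ (x ^ 2 + s ^ 2 / r ^ 2) * r / 2 := by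
  have h1 : (x ^ 2 + s ^ 2 / r ^ 2) * r / 2 = (r * |x| ^ 2 + |s| ^ 2 / r) / 2 := by
    rw [sq_abs, sq_abs]
    field_simp
  have h2 : |s ^ 2 * x| = |s| * (|s| * |x|) := by
    rw [abs_mul, abs_pow]
    ring
  rw [h1, h2]
  have h3 : |s| * (|s| * |x|) ≤ |s| * |x| :=
    mul_le_of_le_one_left (by positivity) hs
  have h4 : (r * |x| ^ 2 + |s| ^ 2 / r) / 2 - |s| * |x| = (r * |x| - |s|) ^ 2 / (2 * r) := by
    field_simp
    ring
  have h5 : 0 ≤ (r * |x| - |s|) ^ 2 / (2 * r) := by positivity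
  linarith

section Exterior

variable {ψ : ℝ → ℝ → ℝ} {W : ℝ × ℝ → ℝ}

theorem IsWaveMap.hasDerivAt_radius (h : IsWaveMap ψ) {t r : ℝ} (ht : 0 < t) (hr : 0 < r) :
    HasDerivAt (ψ t) (pR ψ t r) r := by
  simpa using HasFDerivAt.hasDerivAt_line (h.hasFDerivAt (p := (t, r)) ⟨ht, hr⟩)
    (_root_.hasDerivAt_radius t r)

theorem abs_sinSqPrimitive_le_potential (hwm : IsWaveMap ψ) (hW : IsEnergyPotential ψ W) {k : ℤ}
    {t r : ℝ} (ht : 0 < t) (hr : 0 < r)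
    (hlim : Tendsto (ψ t) atTop (nhds (k * Real.pi))) :
    |sinSqPrimitive (ψ t r - k * Real.pi)| ≤ -W (t, r) / 2 := by
  refine abs_sinSqPrimitive_le_of_tendsto (g := fun r => W (t, r) / 2) k
    (fun x hx => hwm.hasDerivAt_radius ht (hr.trans_le hx))
    (fun x hx => (hasDerivAt_potential_radius hW.hasFDerivAt ht (hr.trans_le hx)).div_const 2)
    (fun x hx => ?_) (fun x hx => ?_) hlim
  · have hx0 := hr.trans_le hx
    refine (abs_sin_sq_mul_le (Real.abs_sin_le_one _) hx0).trans ?_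
    unfold eDen
    gcongr
    nlinarith [sq_nonneg (pT ψ t x)]
  · have := hW.nonpos (t, x) ⟨ht, hr.trans_le hx⟩
    linarith

theorem abs_sinSqPrimitive_le_of_outgoing (hwm : IsWaveMap ψ) (hW : IsEnergyPotential ψ W) {k : ℤ}
    {t r η : ℝ} (ht : 0 < t) (hr : 0 < r)
    (hη : ∀ s, 0 ≤ s → W (t + s, r + s) - W (t, r) ≤ η)
    (hlim : Tendsto (fun s => ψ (t + s) (r + s)) atTop (nhds (k * Real.pi))) :
    |sinSqPrimitive (ψ t r - k * Real.pi)| ≤ η / 2 := by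
  have hq : ∀ x, 0 ≤ x → (t + x, r + x) ∈ quadrant := fun x hx =>
    ⟨add_pos_of_pos_of_nonneg ht hx, add_pos_of_pos_of_nonneg hr hx⟩
  have := abs_sinSqPrimitive_le_of_tendsto (f := fun s => ψ (t + s) (r + s))
    (g := fun s => W (t + s, r + s) / 2) (a := 0) (η := η / 2) k
    (fun x hx => HasFDerivAt.hasDerivAt_line (c := fun s => (t + s, r + s)) (s := x)
      (hwm.hasFDerivAt (hq x hx))
      (hasDerivAt_outgoing t r x))
    (fun x hx => (HasFDerivAt.hasDerivAt_line (c := fun s => (t + s, r + s)) (s := x)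
      (hW.hasFDerivAt _ (hq x hx))
      (hasDerivAt_outgoing t r x)).div_const 2)
    (fun x hx => by
      refine (abs_sin_sq_mul_le (Real.abs_sin_le_one _) (hq x hx).2).trans (le_of_eq ?_)
      simp only [eDen, momDen]
      ring)
    (fun x hx => by
      have := hη x hx
      simp only [add_zero]
      linarith) hlim
  simpa using this

/-- Radial oscillation is controlled by the energy and the logarithm of the ratio of radii. -/
theorem abs_sub_le_potential_add_log (hwm : IsWaveMap ψ) (hW : IsEnergyPotential ψ W)
    {t r₁ r₂ K : ℝ} (ht : 0 < t) (hr : 0 < r₁) (h : r₁ ≤ r₂) (hK : 0 < K) :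
    |ψ t r₂ - ψ t r₁| ≤
      K / 2 * (W (t, r₂) - W (t, r₁)) + (Real.log r₂ - Real.log r₁) / (2 * K) := by
  have := abs_sub_le_of_abs_hasDerivAt_le (f := ψ t)
    (g := fun r => K / 2 * W (t, r) + Real.log r / (2 * K)) h
    (fun x hx => hwm.hasDerivAt_radius ht (hr.trans_le hx.1))
    (fun x hx => ((hasDerivAt_potential_radius hW.hasFDerivAt ht
      (hr.trans_le hx.1)).const_mul (K / 2)).add
      ((Real.hasDerivAt_log (hr.trans_le hx.1).ne').div_const (2 * K)))
    (fun x hx => by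
      have hx0 := hr.trans_le hx.1
      have h1 : |pR ψ t x| ^ 2 * x ≤ eDen ψ t x := by
        rw [sq_abs]
        unfold eDen
        gcongr
        have : 0 ≤ Real.sin (ψ t x) ^ 2 / x ^ 2 := by positivity
        nlinarith [sq_nonneg (pT ψ t x)]
      have h2 := mul_le_mul_of_nonneg_left h1 (by positivity : 0 ≤ K / 2)
      have h3 : K / 2 * (|pR ψ t x| ^ 2 * x) + x⁻¹ / (2 * K) - |pR ψ t x|
          = (K * x * |pR ψ t x| - 1) ^ 2 / (2 * K * x) := by
        field_simp
        ring
      have h4 : 0 ≤ (K * x * |pR ψ t x| - 1) ^ 2 / (2 * K * x) := by positivity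
      linarith)
  refine this.trans (le_of_eq ?_)
  ring

/-- Uniform convergence outside a cone slightly narrower than the light cone. -/
theorem exists_exterior_lt (hwm : IsWaveMap ψ) (hW : IsEnergyPotential ψ W) {k : ℤ}
    (hlim : ∀ t, 0 ≤ t → Tendsto (ψ t) atTop (nhds (k * Real.pi))) {ε : ℝ} (hε : 0 < ε) :
    ∃ μ T, 0 < μ ∧ μ < 1 ∧ ∀ t, T ≤ t → ∀ r, μ * t ≤ r → |ψ t r - k * Real.pi| < ε := by
  obtain ⟨δ, hδ, hδε⟩ := exists_abs_lt_of_abs_sinSqPrimitive_le (half_pos hε)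
  obtain ⟨R, hRW, hR⟩ := (((hW.tendsto 1 one_pos).eventually
    (lt_mem_nhds (by linarith : -2 * δ < 0))).and (eventually_gt_atTop 0)).exists
  have hE : 0 ≤ totE ψ 0 := by
    have h1 := hW.nonpos (1, 1) ⟨mem_Ioi.2 one_pos, mem_Ioi.2 one_pos⟩
    have h2 := hW.neg_energy_le (1, 1) ⟨mem_Ioi.2 one_pos, mem_Ioi.2 one_pos⟩
    linarith
  obtain ⟨K, hK, hKE⟩ : ∃ K : ℝ, 0 < K ∧ K / 2 * totE ψ 0 ≤ ε / 4 := by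
    refine ⟨ε / (2 * (totE ψ 0 + 1)), by positivity, ?_⟩
    rw [div_div, div_mul_eq_mul_div, div_le_div_iff₀ (by positivity) (by positivity)]
    nlinarith
  obtain ⟨κ, hκ, hκ1, hκK⟩ : ∃ κ : ℝ, 0 < κ ∧ κ ≤ 1 ∧ 3 * κ ≤ K * ε / 4 := by
    refine ⟨min 1 (K * ε / 12), by positivity, min_le_left _ _, ?_⟩
    linarith [min_le_right 1 (K * ε / 12)]
  have hfar : ∀ t, 1 ≤ t → ∀ r, R + t ≤ r → |ψ t r - k * Real.pi| < ε / 2 := by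
    intro t ht r hr
    have ht0 : 0 < t := by linarith
    have hr0 : 0 < r := by linarith
    apply hδε
    refine (abs_sinSqPrimitive_le_potential hwm hW ht0 hr0 (hlim t ht0.le)).trans ?_
    have h1 := potential_le_outgoing hW.hasFDerivAt one_pos hR (sub_nonneg.2 ht)
    have h2 := le_of_hasDerivAt_nonpos (f := fun r => -W (t, r))
      (by linarith : R + (t - 1) ≤ r)
      (fun x hx => (hasDerivAt_potential_radius hW.hasFDerivAt ht0 (by linarith [hx.1])).neg)
      (fun x hx => neg_nonpos.2 (eDen_nonneg ψ t (by linarith [hx.1])))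
    rw [add_sub_cancel] at h1
    linarith
  refine ⟨1 / (1 + κ), max 1 (R / κ), by positivity, ?_, fun t ht r hr => ?_⟩
  · rw [div_lt_one (by positivity)]
    linarith
  have ht1 : 1 ≤ t := (le_max_left _ _).trans ht
  have ht0 : 0 < t := by linarith
  have hRt : R ≤ κ * t := by
    have := (le_max_right _ _).trans ht
    rwa [div_le_iff₀ hκ, mul_comm] at this
  rcases le_total (R + t) r with h | h
  · linarith [hfar t ht1 r h]
  have hμ : 0 < 1 / (1 + κ) * t := by positivity
  have hr0 : 0 < r := hμ.trans_le hr
  have h1 := abs_sub_le_potential_add_log hwm hW ht0 hr0 h hK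
  have h2 := hfar t ht1 (R + t) le_rfl
  have h3 : W (t, R + t) - W (t, r) ≤ totE ψ 0 := by
    have e1 := hW.nonpos (t, R + t) ⟨mem_Ioi.2 ht0, mem_Ioi.2 (by linarith)⟩
    have e2 := hW.neg_energy_le (t, r) ⟨mem_Ioi.2 ht0, mem_Ioi.2 hr0⟩
    linarith
  have h4 : Real.log (R + t) - Real.log r ≤ 3 * κ := by
    rw [← Real.log_div (by linarith) hr0.ne']
    have hpos : 0 < (R + t) / r := div_pos (by linarith) hr0
    have e1 := Real.log_le_sub_one_of_pos hpos
    have e2 : (R + t) / r ≤ 1 + 3 * κ := by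
      rw [div_le_iff₀ hr0]
      have e3 : t ≤ (1 + κ) * r := by
        rw [one_div, inv_mul_le_iff₀ (by positivity)] at hr
        exact hr
      nlinarith [mul_nonneg hκ.le hr0.le, mul_le_mul_of_nonneg_left e3 hκ.le,
        mul_le_mul_of_nonneg_left hκ1 (mul_nonneg hκ.le hr0.le)]
    linarith
  have h5 : (Real.log (R + t) - Real.log r) / (2 * K) ≤ ε / 8 := by
    rw [div_le_iff₀ (by positivity)]
    linarith
  have h6 := mul_le_mul_of_nonneg_left h3 (by positivity : 0 ≤ K / 2)
  have h7 : |ψ t r - k * Real.pi| ≤ |ψ t (R + t) - ψ t r| + |ψ t (R + t) - k * Real.pi| := by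
    rw [abs_sub_comm (ψ t (R + t)) (ψ t r)]
    exact abs_sub_le _ _ _
  linarith

end Exterior

/-- uniform convergence of `ψ(t)` to `kπ` in the exterior region `r ≥ λt`. -/
theorem stmt3_uniform_convergence_exterior
    (ψ : ℝ → ℝ → ℝ) (k : ℤ)
    (hwm : IsWaveMap ψ) (hfe : FiniteEnergy ψ) (hcons : EnergyConserved ψ)
    (hbcinf : ∀ t : ℝ, 0 ≤ t → Filter.Tendsto (ψ t) Filter.atTop (nhds (k * Real.pi)))
    (lam : ℝ) (hlam : 0 < lam) :
    ∀ ε > 0, ∃ T : ℝ, ∀ t : ℝ, T ≤ t → ∀ r : ℝ, lam * t ≤ r →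
      |ψ t r - k * Real.pi| < ε := by
  intro ε hε
  obtain ⟨W, hW⟩ := exists_isEnergyPotential hwm hfe hcons
  obtain ⟨a, b, l, hw⟩ := hW.exists_isNullPotential hwm
  obtain ⟨δ, hδ, hδε⟩ := exists_abs_lt_of_abs_sinSqPrimitive_le hε
  obtain ⟨ν, hν, hνlam, hν1⟩ : ∃ ν : ℝ, 0 < ν ∧ ν ≤ lam ∧ ν < 1 :=
    ⟨min lam (1 / 2), by positivity, min_le_left _ _, (min_le_right _ _).trans_lt (by norm_num)⟩
  have hq : ∀ u v : ℝ, 0 < u → u < v → ((u + v) / 2, (v - u) / 2) ∈ quadrant :=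
    fun u v hu huv => ⟨mem_Ioi.2 (by linarith), mem_Ioi.2 (by linarith)⟩
  obtain ⟨A, V, hA, hAV⟩ := hw.flux_tendsto_zero (θ := (1 - ν) / (1 + ν)) (m := -totE ψ 0)
    (M := 0) (ε := 2 * δ) (div_pos (by linarith) (by linarith))
    ((div_lt_one (by linarith)).2 (by linarith))
    (fun u v hu huv => hW.neg_energy_le _ (hq u v hu huv))
    (fun u v hu huv => hW.nonpos _ (hq u v hu huv)) (by positivity)
  obtain ⟨μ, T, hμ, hμ1, hT⟩ := exists_exterior_lt hwm hW hbcinf hε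
  refine ⟨max (max 1 T) (max V (A / (1 - μ))), fun t ht r hr => ?_⟩
  have ht1 : 1 ≤ t := ((le_max_left _ _).trans (le_max_left _ _)).trans ht
  have htT : T ≤ t := ((le_max_right _ _).trans (le_max_left _ _)).trans ht
  have htV : V ≤ t := ((le_max_left _ _).trans (le_max_right _ _)).trans ht
  have htA : A ≤ t * (1 - μ) := by
    rw [← div_le_iff₀ (by linarith)]
    exact ((le_max_right _ _).trans (le_max_right _ _)).trans ht
  have ht0 : 0 < t := by linarith
  have hνr : ν * t ≤ r := (mul_le_mul_of_nonneg_right hνlam ht0.le).trans hr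
  have hr0 : 0 < r := (by positivity : 0 < ν * t).trans_le hνr
  rcases le_total (μ * t) r with h | h
  · exact hT t htT r h
  apply hδε
  have hlim : Tendsto (fun s => ψ (t + s) (r + s)) atTop (nhds (k * Real.pi)) := by
    rw [Metric.tendsto_atTop]
    intro ε' hε'
    obtain ⟨μ', T', hμ', hμ1', hT'⟩ := exists_exterior_lt hwm hW hbcinf hε'
    refine ⟨max T' (μ' * t / (1 - μ')), fun s hs => ?_⟩
    rw [Real.dist_eq]
    refine hT' (t + s) (by linarith [(le_max_left _ _).trans hs]) (r + s) ?_
    have := (le_max_right _ _).trans hs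
    rw [div_le_iff₀ (by linarith)] at this
    linarith
  have hflux : ∀ s, 0 ≤ s → W (t + s, r + s) - W (t, r) ≤ 2 * δ := by
    intro s hs
    have := hAV (t + r) (by linarith) (t - r) (by linarith)
      (by
        rw [div_mul_eq_mul_div, le_div_iff₀ (by linarith)]
        linarith) (t + r + 2 * s) (by linarith)
    have e1 : (t - r + (t + r + 2 * s)) / 2 = t + s := by ring
    have e2 : (t + r + 2 * s - (t - r)) / 2 = r + s := by ring
    have e3 : (t - r + (t + r)) / 2 = t := by ring
    have e4 : (t + r - (t - r)) / 2 = r := by ring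
    simpa only [e1, e2, e3, e4] using this
  have := abs_sinSqPrimitive_le_of_outgoing hwm hW ht0 hr0 hflux hlim
  linarith
end
end

section
/- Let ψ be a smooth global finite-energy 1-equivariant wave map with ψ(t,∞) = kπ for all t (k a fixed integer), and fix 0 < λ < 1. Then limsup_{t→∞} ‖ψ⃗(t) − (kπ, 0)‖²_{H×L²(λt ≤ r ≤ t−A)} → 0 as A → ∞. -/
open MeasureTheory Real Filter Set

noncomputable section

/-- The future quadrant `{t > 0, r > 0}` in null coordinates `u = t - r`, `v = t + r`. -/
def nullQuadrant : Set (ℝ × ℝ) := {p | 0 < p.1 + p.2 ∧ p.1 < p.2}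

/-- A pair of nonnegative null energy densities satisfying `∂ᵤα = ℓ`, `∂ᵥβ = -ℓ`, where the
exchange term `ℓ` is controlled by `√(αβ) / (v - u)`. -/
structure IsNullPair (α β ℓ : ℝ → ℝ → ℝ) (C : ℝ) : Prop where
  cont_left : ContinuousOn (fun p : ℝ × ℝ => α p.1 p.2) nullQuadrant
  cont_right : ContinuousOn (fun p : ℝ × ℝ => β p.1 p.2) nullQuadrant
  cont_exchange : ContinuousOn (fun p : ℝ × ℝ => ℓ p.1 p.2) nullQuadrant
  nonneg_left : ∀ u v, (u, v) ∈ nullQuadrant → 0 ≤ α u v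
  nonneg_right : ∀ u v, (u, v) ∈ nullQuadrant → 0 ≤ β u v
  deriv_left : ∀ u v, (u, v) ∈ nullQuadrant → HasDerivAt (fun x => α x v) (ℓ u v) u
  deriv_right : ∀ u v, (u, v) ∈ nullQuadrant → HasDerivAt (fun y => β u y) (-ℓ u v) v
  exchange_sq_le : ∀ u v, (u, v) ∈ nullQuadrant →
    (ℓ u v) ^ 2 * (v - u) ^ 2 ≤ C * (α u v * β u v)

/-- Fubini for a function which is continuous on a compact set and integrated over it. -/
theorem integral_integral_indicator_swap {K : Set (ℝ × ℝ)} (hK : IsCompact K)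
    {f : ℝ × ℝ → ℝ} (hf : ContinuousOn f K) :
    ∫ x, ∫ y, K.indicator f (x, y) = ∫ y, ∫ x, K.indicator f (x, y) := by
  have hi : Integrable (K.indicator f) (volume.prod volume) := by
    rw [integrable_indicator_iff hK.measurableSet]
    exact hf.integrableOn_compact hK
  exact integral_integral_swap (f := fun x y => K.indicator f (x, y)) hi

theorem integral_indicator_Icc_eq_interval {a b : ℝ} (h : a ≤ b) (g : ℝ → ℝ) :
    ∫ x, (Icc a b).indicator g x = ∫ x in a..b, g x := by
  rw [integral_indicator measurableSet_Icc, integral_Icc_eq_integral_Ioc,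
    intervalIntegral.integral_of_le h]

theorem integrable_prod_restrict_of_continuousOn {a b c d : ℝ} {f : ℝ → ℝ → ℝ}
    (hf : ContinuousOn (fun p : ℝ × ℝ => f p.1 p.2) (Icc a b ×ˢ Icc c d)) :
    Integrable (Function.uncurry f)
      ((volume.restrict (Ioc a b)).prod (volume.restrict (Ioc c d))) := by
  rw [Measure.prod_restrict]
  exact (hf.integrableOn_compact (isCompact_Icc.prod isCompact_Icc)).mono_set
    (prod_mono Ioc_subset_Icc_self Ioc_subset_Icc_self)

/-- Fubini on a rectangle for continuous functions. -/
theorem intervalIntegral_swap_of_continuousOn {a b c d : ℝ} (hab : a ≤ b) (hcd : c ≤ d)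
    {f : ℝ → ℝ → ℝ}
    (hf : ContinuousOn (fun p : ℝ × ℝ => f p.1 p.2) (Icc a b ×ˢ Icc c d)) :
    ∫ x in a..b, ∫ y in c..d, f x y = ∫ y in c..d, ∫ x in a..b, f x y := by
  simp only [intervalIntegral.integral_of_le hab, intervalIntegral.integral_of_le hcd]
  exact integral_integral_swap (integrable_prod_restrict_of_continuousOn hf)

/-- A partial integral of a continuous function on a rectangle is integrable. -/
theorem intervalIntegrable_partial_of_continuousOn {a b c d : ℝ} (hab : a ≤ b) (hcd : c ≤ d)
    {f : ℝ → ℝ → ℝ}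
    (hf : ContinuousOn (fun p : ℝ × ℝ => f p.1 p.2) (Icc a b ×ˢ Icc c d)) :
    IntervalIntegrable (fun x => ∫ y in c..d, f x y) volume a b := by
  rw [intervalIntegrable_iff_integrableOn_Ioc_of_le hab]
  simp only [intervalIntegral.integral_of_le hcd]
  exact (integrable_prod_restrict_of_continuousOn hf).integral_prod_left

namespace IsNullPair

variable {α β ℓ : ℝ → ℝ → ℝ} {C : ℝ}

theorem continuousOn_left_row (h : IsNullPair α β ℓ C) {u a b : ℝ}
    (hs : ∀ v ∈ Icc a b, (u, v) ∈ nullQuadrant) : ContinuousOn (fun v => α u v) (Icc a b) :=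
  h.cont_left.comp (f := fun v : ℝ => (u, v)) (by fun_prop) hs

theorem continuousOn_right_column (h : IsNullPair α β ℓ C) {v a b : ℝ}
    (hs : ∀ u ∈ Icc a b, (u, v) ∈ nullQuadrant) : ContinuousOn (fun u => β u v) (Icc a b) :=
  h.cont_right.comp (f := fun u : ℝ => (u, v)) (by fun_prop) hs

theorem continuousOn_exchange_row (h : IsNullPair α β ℓ C) {u a b : ℝ}
    (hs : ∀ v ∈ Icc a b, (u, v) ∈ nullQuadrant) : ContinuousOn (fun v => ℓ u v) (Icc a b) :=
  h.cont_exchange.comp (f := fun v : ℝ => (u, v)) (by fun_prop) hs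

theorem continuousOn_exchange_column (h : IsNullPair α β ℓ C) {v a b : ℝ}
    (hs : ∀ u ∈ Icc a b, (u, v) ∈ nullQuadrant) : ContinuousOn (fun u => ℓ u v) (Icc a b) :=
  h.cont_exchange.comp (f := fun u : ℝ => (u, v)) (by fun_prop) hs

theorem continuousOn_left_slice (h : IsNullPair α β ℓ C) {T a b : ℝ}
    (hs : ∀ u ∈ Icc a b, (u, 2 * T - u) ∈ nullQuadrant) :
    ContinuousOn (fun u => α u (2 * T - u)) (Icc a b) :=
  h.cont_left.comp (f := fun u : ℝ => (u, 2 * T - u)) (by fun_prop) hs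

theorem continuousOn_right_slice (h : IsNullPair α β ℓ C) {T a b : ℝ}
    (hs : ∀ u ∈ Icc a b, (u, 2 * T - u) ∈ nullQuadrant) :
    ContinuousOn (fun u => β u (2 * T - u)) (Icc a b) :=
  h.cont_right.comp (f := fun u : ℝ => (u, 2 * T - u)) (by fun_prop) hs

theorem integral_exchange_row (h : IsNullPair α β ℓ C) {u a b : ℝ} (hab : a ≤ b)
    (hs : ∀ v ∈ Icc a b, (u, v) ∈ nullQuadrant) :
    ∫ v in a..b, ℓ u v = β u a - β u b := by
  have := intervalIntegral.integral_eq_sub_of_hasDerivAt (f := fun y => -β u y)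
    (f' := fun v => ℓ u v) (a := a) (b := b)
    (fun v hv => by
      rw [uIcc_of_le hab] at hv
      simpa using (h.deriv_right u v (hs v hv)).fun_neg)
    ((h.continuousOn_exchange_row hs).intervalIntegrable_of_Icc hab)
  rw [this]; ring

theorem integral_exchange_column (h : IsNullPair α β ℓ C) {v a b : ℝ} (hab : a ≤ b)
    (hs : ∀ u ∈ Icc a b, (u, v) ∈ nullQuadrant) :
    ∫ u in a..b, ℓ u v = α b v - α a v :=
  intervalIntegral.integral_eq_sub_of_hasDerivAt (f := fun x => α x v)
    (fun u hu => by
      rw [uIcc_of_le hab] at hu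
      exact h.deriv_left u v (hs u hu))
    ((h.continuousOn_exchange_column hs).intervalIntegrable_of_Icc hab)

/-- Conservation of energy in the characteristic triangle above the time slice `u + v = 2T`. -/
theorem integral_slice_eq (h : IsNullPair α β ℓ C) {T U V : ℝ} (hT : 0 < T) (hU : U < T)
    (hV : 2 * T - V ≤ U) :
    ∫ u in (2 * T - V)..U, (α u (2 * T - u) + β u (2 * T - u)) =
      (∫ v in (2 * T - U)..V, α U v) + ∫ u in (2 * T - V)..U, β u V := by
  have hV' : 2 * T - U ≤ V := by linarith
  set K : Set (ℝ × ℝ) := {p | p.1 ≤ U ∧ p.2 ≤ V ∧ 2 * T ≤ p.1 + p.2} with hKdef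
  have hKc : IsClosed K := by
    refine (isClosed_le continuous_fst continuous_const).inter
      ((isClosed_le continuous_snd continuous_const).inter
        (isClosed_le continuous_const (continuous_fst.add continuous_snd)))
  have hK : IsCompact K := by
    refine (isCompact_Icc.prod isCompact_Icc).of_isClosed_subset
      (s := Icc (2 * T - V) U ×ˢ Icc (2 * T - U) V) hKc ?_
    rintro ⟨u, v⟩ ⟨h1, h2, h3⟩
    simp only at h1 h2 h3
    exact ⟨⟨by simp only; linarith, h1⟩, ⟨by simp only; linarith, h2⟩⟩
  have hsub : K ⊆ nullQuadrant := by
    rintro ⟨u, v⟩ ⟨h1, h2, h3⟩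
    simp only at h1 h2 h3
    constructor <;> simp only <;> linarith
  have hmem : ∀ u v, u ≤ U → v ≤ V → 2 * T ≤ u + v → (u, v) ∈ nullQuadrant :=
    fun u v h1 h2 h3 => hsub ⟨h1, h2, h3⟩
  have hswap := integral_integral_indicator_swap hK (h.cont_exchange.mono hsub)
  have hrow : (fun u => ∫ v, K.indicator (fun p : ℝ × ℝ => ℓ p.1 p.2) (u, v)) =
      (Icc (2 * T - V) U).indicator (fun u => β u (2 * T - u) - β u V) := by
    funext u
    by_cases hu : u ∈ Icc (2 * T - V) U
    · rw [indicator_of_mem hu]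
      have : (fun v => K.indicator (fun p : ℝ × ℝ => ℓ p.1 p.2) (u, v)) =
          (Icc (2 * T - u) V).indicator (fun v => ℓ u v) := by
        funext v
        by_cases hv : v ∈ Icc (2 * T - u) V
        · rw [indicator_of_mem hv,
            indicator_of_mem (show (u, v) ∈ K from ⟨hu.2, hv.2, by simp only; linarith [hv.1]⟩)]
        · rw [indicator_of_notMem hv, indicator_of_notMem]
          rintro ⟨_, h2, h3⟩
          simp only at h2 h3
          exact hv ⟨by linarith, h2⟩
      rw [this, integral_indicator_Icc_eq_interval (by linarith [hu.1]),
        h.integral_exchange_row (by linarith [hu.1])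
          (fun v hv => hmem u v hu.2 hv.2 (by linarith [hv.1]))]
    · rw [indicator_of_notMem hu]
      have : (fun v => K.indicator (fun p : ℝ × ℝ => ℓ p.1 p.2) (u, v)) = fun _ => 0 := by
        funext v
        rw [indicator_of_notMem]
        rintro ⟨h1, h2, h3⟩
        simp only at h1 h2 h3
        exact hu ⟨by linarith, h1⟩
      rw [this, integral_zero]
  have hcol : (fun v => ∫ u, K.indicator (fun p : ℝ × ℝ => ℓ p.1 p.2) (u, v)) =
      (Icc (2 * T - U) V).indicator (fun v => α U v - α (2 * T - v) v) := by
    funext v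
    by_cases hv : v ∈ Icc (2 * T - U) V
    · rw [indicator_of_mem hv]
      have : (fun u => K.indicator (fun p : ℝ × ℝ => ℓ p.1 p.2) (u, v)) =
          (Icc (2 * T - v) U).indicator (fun u => ℓ u v) := by
        funext u
        by_cases hu : u ∈ Icc (2 * T - v) U
        · rw [indicator_of_mem hu,
            indicator_of_mem (show (u, v) ∈ K from ⟨hu.2, hv.2, by simp only; linarith [hu.1]⟩)]
        · rw [indicator_of_notMem hu, indicator_of_notMem]
          rintro ⟨h1, _, h3⟩
          simp only at h1 h3
          exact hu ⟨by linarith, h1⟩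
      rw [this, integral_indicator_Icc_eq_interval (by linarith [hv.1]),
        h.integral_exchange_column (by linarith [hv.1])
          (fun u hu => hmem u v hu.2 hv.2 (by linarith [hu.1]))]
    · rw [indicator_of_notMem hv]
      have : (fun u => K.indicator (fun p : ℝ × ℝ => ℓ p.1 p.2) (u, v)) = fun _ => 0 := by
        funext u
        rw [indicator_of_notMem]
        rintro ⟨h1, h2, h3⟩
        simp only at h1 h2 h3
        exact hv ⟨by linarith, h2⟩
      rw [this, integral_zero]
  rw [hrow, hcol, integral_indicator_Icc_eq_interval hV, integral_indicator_Icc_eq_interval hV']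
    at hswap
  have hslice : ∀ u ∈ Icc (2 * T - V) U, (u, 2 * T - u) ∈ nullQuadrant :=
    fun u hu => hmem u _ hu.2 (by linarith [hu.1]) (by linarith)
  have iα := (h.continuousOn_left_slice hslice).intervalIntegrable_of_Icc (μ := volume) hV
  have iβ := (h.continuousOn_right_slice hslice).intervalIntegrable_of_Icc (μ := volume) hV
  have iβV := (h.continuousOn_right_column (v := V) (a := 2 * T - V) (b := U)
    (fun u hu => hmem u V hu.2 le_rfl (by linarith [hu.1]))).intervalIntegrable_of_Icc
      (μ := volume) hV
  have iαU := (h.continuousOn_left_row (u := U) (a := 2 * T - U) (b := V)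
    (fun v hv => hmem U v le_rfl hv.2 (by linarith [hv.1]))).intervalIntegrable_of_Icc
      (μ := volume) hV'
  have iα' : IntervalIntegrable (fun v => α (2 * T - v) v) volume (2 * T - U) V := by
    refine ContinuousOn.intervalIntegrable_of_Icc hV' ?_
    exact h.cont_left.comp (f := fun v : ℝ => (2 * T - v, v)) (by fun_prop)
      (fun v hv => hmem _ v (by linarith [hv.1]) hv.2 (by linarith))
  rw [intervalIntegral.integral_sub iβ iβV, intervalIntegral.integral_sub iαU iα'] at hswap
  have hsubst : ∫ v in (2 * T - U)..V, α (2 * T - v) v =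
      ∫ u in (2 * T - V)..U, α u (2 * T - u) := by
    have := intervalIntegral.integral_comp_sub_left (a := 2 * T - U) (b := V)
      (fun u => α u (2 * T - u)) (2 * T)
    simpa using this
  rw [intervalIntegral.integral_add iα iβ]
  linarith [hswap, hsubst]

/-- A weighted energy estimate on a characteristic rectangle on which `v - u ≥ M`: the flux
leaving through `u = U` is controlled by the fluxes through `u = A` and `v = V`. -/
theorem flux_le_of_rectangle (h : IsNullPair α β ℓ C) (hC : 0 ≤ C) {A U V₀ V M : ℝ}
    (hA : 0 ≤ A) (hAU : A ≤ U) (hV : V₀ ≤ V) (hM : 0 < M) (hMV : M ≤ V₀ - U) :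
    Real.exp (-(9 * C / (4 * M) * U)) * ∫ v in V₀..V, α U v ≤
      (∫ v in V₀..V, α A v) + 2 * ∫ u in A..U, β u V := by
  set κ : ℝ := 9 * C / (4 * M) with hκ
  have hκ0 : 0 ≤ κ := by positivity
  have hκM : 4 * (κ * M) = 9 * C := by rw [hκ]; field_simp
  have hsub : Icc A U ×ˢ Icc V₀ V ⊆ nullQuadrant := by
    rintro ⟨u, v⟩ ⟨⟨h1, h2⟩, ⟨h3, h4⟩⟩
    simp only at h1 h2 h3 h4
    constructor <;> simp only <;> linarith
  have hmem : ∀ u v, u ∈ Icc A U → v ∈ Icc V₀ V → (u, v) ∈ nullQuadrant :=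
    fun u v hu hv => hsub ⟨hu, hv⟩
  have hD : ∀ u v, u ∈ Icc A U → v ∈ Icc V₀ V → M ≤ v - u :=
    fun u v hu hv => by linarith [hu.2, hv.1]
  set w : ℝ → ℝ := fun u => Real.exp (-(κ * u)) with hw
  have hw0 : ∀ u, 0 < w u := fun u => Real.exp_pos _
  have hwd : ∀ u, HasDerivAt w (-κ * w u) u := fun u => by
    have : HasDerivAt (fun u : ℝ => -(κ * u)) (-(κ * 1)) u :=
      ((hasDerivAt_id u).const_mul κ).neg
    convert this.exp using 1
    simp only [hw]; ring
  have hwc : Continuous w := by fun_prop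
  set p : ℝ → ℝ → ℝ := fun u v => -κ * w u * α u v + w u * ℓ u v with hp
  set q : ℝ → ℝ → ℝ := fun u v => w u * (M / (v - u) ^ 2) * β u v +
    w u * (2 - M / (v - u)) * (-ℓ u v) with hq
  have hpc : ContinuousOn (fun z : ℝ × ℝ => p z.1 z.2) (Icc A U ×ˢ Icc V₀ V) := by
    have h1 := h.cont_left.mono hsub
    have h2 := h.cont_exchange.mono hsub
    simp only [hp]
    fun_prop
  have hqc : ContinuousOn (fun z : ℝ × ℝ => q z.1 z.2) (Icc A U ×ˢ Icc V₀ V) := by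
    have h1 := h.cont_right.mono hsub
    have h2 := h.cont_exchange.mono hsub
    have h0 : ∀ z ∈ Icc A U ×ˢ Icc V₀ V, z.2 - z.1 ≠ 0 := fun z hz =>
      (hM.trans_le (hD z.1 z.2 hz.1 hz.2)).ne'
    have h3 : ContinuousOn (fun z : ℝ × ℝ => M / (z.2 - z.1)) (Icc A U ×ˢ Icc V₀ V) :=
      ContinuousOn.div (by fun_prop) (by fun_prop) h0
    have h4 : ContinuousOn (fun z : ℝ × ℝ => M / (z.2 - z.1) ^ 2) (Icc A U ×ˢ Icc V₀ V) :=
      ContinuousOn.div (by fun_prop) (by fun_prop) (fun z hz => pow_ne_zero 2 (h0 z hz))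
    simp only [hq]
    fun_prop
  have hpq : ∀ u v, u ∈ Icc A U → v ∈ Icc V₀ V → p u v ≤ q u v := by
    intro u v hu hv
    have hd := hD u v hu hv
    have hd0 : 0 < v - u := hM.trans_le hd
    have hα := h.nonneg_left u v (hmem u v hu hv)
    have hβ := h.nonneg_right u v (hmem u v hu hv)
    have hl := h.exchange_sq_le u v (hmem u v hu hv)
    set y : ℝ := M / (v - u) with hy
    have hy0 : 0 < y := by positivity
    have hy1 : y ≤ 1 := (div_le_one hd0).2 hd
    set x : ℝ := κ * α u v with hx
    set z : ℝ := M / (v - u) ^ 2 * β u v with hz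
    have hx0 : 0 ≤ x := by positivity
    have hz0 : 0 ≤ z := by positivity
    have hsq : (3 * ℓ u v) ^ 2 ≤ (x + z) ^ 2 := by
      have h1 : (3 * ℓ u v) ^ 2 ≤ 4 * (x * z) := by
        have : 4 * (x * z) = 9 * (C * (α u v * β u v)) / (v - u) ^ 2 := by
          rw [hx, hz, ← mul_assoc 9 C, ← hκM]; ring
        rw [this, le_div_iff₀ (by positivity)]
        nlinarith [hl]
      nlinarith [sq_nonneg (x - z)]
    have h3 : |3 * ℓ u v| ≤ x + z := abs_le_of_sq_le_sq hsq (by positivity)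
    have h4 : (3 - y) * ℓ u v ≤ x + z := by
      calc (3 - y) * ℓ u v ≤ (3 - y) * |ℓ u v| :=
            mul_le_mul_of_nonneg_left (le_abs_self _) (by linarith)
        _ ≤ 3 * |ℓ u v| := mul_le_mul_of_nonneg_right (by linarith) (abs_nonneg _)
        _ = |3 * ℓ u v| := by rw [abs_mul]; norm_num
        _ ≤ x + z := h3
    have : q u v - p u v = w u * (x + z - (3 - y) * ℓ u v) := by
      simp only [hp, hq, hx, hz, hy]; ring
    have h5 : 0 ≤ w u * (x + z - (3 - y) * ℓ u v) :=
      mul_nonneg (hw0 u).le (by linarith)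
    linarith
  have hpint : ∀ v ∈ Icc V₀ V, ∫ u in A..U, p u v = w U * α U v - w A * α A v := by
    intro v hv
    refine intervalIntegral.integral_eq_sub_of_hasDerivAt (f := fun u => w u * α u v)
      (fun u hu => ?_) ?_
    · rw [uIcc_of_le hAU] at hu
      exact (hwd u).mul (h.deriv_left u v (hmem u v hu hv))
    · refine ContinuousOn.intervalIntegrable_of_Icc hAU ?_
      exact hpc.comp (f := fun u : ℝ => (u, v)) (by fun_prop) (fun u hu => ⟨hu, hv⟩)
  have hqint : ∀ u ∈ Icc A U, ∫ v in V₀..V, q u v =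
      w u * (2 - M / (V - u)) * β u V - w u * (2 - M / (V₀ - u)) * β u V₀ := by
    intro u hu
    refine intervalIntegral.integral_eq_sub_of_hasDerivAt
      (f := fun v => w u * (2 - M / (v - u)) * β u v) (fun v hv => ?_) ?_
    · rw [uIcc_of_le hV] at hv
      have hd0 : v - u ≠ 0 := (hM.trans_le (hD u v hu hv)).ne'
      have h1 : HasDerivAt (fun v : ℝ => w u * (2 - M / (v - u))) (w u * (M / (v - u) ^ 2)) v := by
        have h2 : HasDerivAt (fun v : ℝ => v - u) 1 v := (hasDerivAt_id v).sub_const u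
        exact ((((hasDerivAt_const v M).fun_div h2 hd0).const_sub 2).const_mul (w u)).congr_deriv
          (by ring)
      exact h1.mul (h.deriv_right u v (hmem u v hu hv))
    · refine ContinuousOn.intervalIntegrable_of_Icc hV ?_
      exact hqc.comp (f := fun v : ℝ => (u, v)) (by fun_prop) (fun v hv => ⟨hu, hv⟩)
  have rowU := (h.continuousOn_left_row (u := U) (a := V₀) (b := V)
    (fun v hv => hmem U v ⟨hAU, le_rfl⟩ hv)).intervalIntegrable_of_Icc (μ := volume) hV
  have rowA := (h.continuousOn_left_row (u := A) (a := V₀) (b := V)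
    (fun v hv => hmem A v ⟨le_rfl, hAU⟩ hv)).intervalIntegrable_of_Icc (μ := volume) hV
  have colV := (h.continuousOn_right_column (v := V) (a := A) (b := U)
    (fun u hu => hmem u V hu ⟨hV, le_rfl⟩)).intervalIntegrable_of_Icc (μ := volume) hAU
  have e1 : ∫ v in V₀..V, ∫ u in A..U, p u v =
      w U * (∫ v in V₀..V, α U v) - w A * ∫ v in V₀..V, α A v := by
    rw [← intervalIntegral.integral_const_mul, ← intervalIntegral.integral_const_mul,
      ← intervalIntegral.integral_sub (rowU.const_mul _) (rowA.const_mul _)]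
    refine intervalIntegral.integral_congr (fun v hv => ?_)
    rw [uIcc_of_le hV] at hv
    exact hpint v hv
  have qi : IntervalIntegrable (fun u => ∫ v in V₀..V, q u v) volume A U :=
    intervalIntegrable_partial_of_continuousOn hAU hV hqc
  have e2 : ∫ u in A..U, ∫ v in V₀..V, q u v ≤ 2 * ∫ u in A..U, β u V := by
    rw [← intervalIntegral.integral_const_mul]
    refine intervalIntegral.integral_mono_on hAU qi (colV.const_mul 2) (fun u hu => ?_)
    rw [hqint u hu]
    have hβ := h.nonneg_right u V (hmem u V hu ⟨hV, le_rfl⟩)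
    have hβ0 := h.nonneg_right u V₀ (hmem u V₀ hu ⟨le_rfl, hV⟩)
    have hw1 : w u ≤ 1 := Real.exp_le_one_iff.2 (by nlinarith [hu.1])
    have y1 : 0 ≤ M / (V - u) := div_nonneg hM.le (by linarith [hD u V hu ⟨hV, le_rfl⟩])
    have y1' : M / (V - u) ≤ 1 :=
      (div_le_one (by linarith [hD u V hu ⟨hV, le_rfl⟩])).2 (hD u V hu ⟨hV, le_rfl⟩)
    have y2 : M / (V₀ - u) ≤ 1 :=
      (div_le_one (by linarith [hD u V₀ hu ⟨le_rfl, hV⟩])).2 (hD u V₀ hu ⟨le_rfl, hV⟩)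
    have t1 : 0 ≤ w u * (2 - M / (V₀ - u)) * β u V₀ :=
      mul_nonneg (mul_nonneg (hw0 u).le (by linarith)) hβ0
    have t2 : w u * (2 - M / (V - u)) ≤ 2 := by
      nlinarith [hw0 u]
    nlinarith [mul_le_mul_of_nonneg_right t2 hβ]
  have pi : IntervalIntegrable (fun u => ∫ v in V₀..V, p u v) volume A U :=
    intervalIntegrable_partial_of_continuousOn hAU hV hpc
  have e3 : ∫ u in A..U, ∫ v in V₀..V, p u v ≤ ∫ u in A..U, ∫ v in V₀..V, q u v := by
    refine intervalIntegral.integral_mono_on hAU pi qi (fun u hu => ?_)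
    refine intervalIntegral.integral_mono_on hV ?_ ?_ (fun v hv => hpq u v hu hv)
    · exact (hpc.comp (f := fun v : ℝ => (u, v)) (by fun_prop)
        (fun v hv => ⟨hu, hv⟩)).intervalIntegrable_of_Icc hV
    · exact (hqc.comp (f := fun v : ℝ => (u, v)) (by fun_prop)
        (fun v hv => ⟨hu, hv⟩)).intervalIntegrable_of_Icc hV
  rw [intervalIntegral_swap_of_continuousOn hAU hV hpc, e1] at e3
  have hA' : 0 ≤ ∫ v in V₀..V, α A v :=
    intervalIntegral.integral_nonneg hV
      (fun v hv => h.nonneg_left A v (hmem A v ⟨le_rfl, hAU⟩ hv))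
  have hwA : w A ≤ 1 := Real.exp_le_one_iff.2 (by nlinarith)
  have := mul_le_mul_of_nonneg_right hwA hA'
  have hgoal : w U * (∫ v in V₀..V, α U v) ≤
      (∫ v in V₀..V, α A v) + 2 * ∫ u in A..U, β u V := by linarith
  exact hgoal

/-- Energy balance in the region bounded by the time slice `u + v = 2T` from below. -/
theorem integral_slice_strip_eq (h : IsNullPair α β ℓ C) {T A U V : ℝ} (hT : 0 < T)
    (hAU : A ≤ U) (hU : U < T) (hV : 2 * T - V ≤ A) :
    ∫ u in A..U, (α u (2 * T - u) + β u (2 * T - u)) =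
      (∫ v in (2 * T - U)..V, α U v) - (∫ v in (2 * T - A)..V, α A v) +
        ∫ u in A..U, β u V := by
  have e1 := h.integral_slice_eq hT hU (hV.trans hAU)
  have e2 := h.integral_slice_eq hT (hAU.trans_lt hU) hV
  have hVU := hV.trans hAU
  have hs : ContinuousOn (fun u => α u (2 * T - u) + β u (2 * T - u)) (Icc (2 * T - V) U) := by
    have hm : ∀ u ∈ Icc (2 * T - V) U, (u, 2 * T - u) ∈ nullQuadrant := fun u hu => by
      constructor <;> simp only <;> linarith [hu.2]
    exact (h.continuousOn_left_slice hm).add (h.continuousOn_right_slice hm)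
  have hb : ContinuousOn (fun u => β u V) (Icc (2 * T - V) U) :=
    h.continuousOn_right_column (fun u hu => by
      constructor <;> simp only <;> linarith [hu.1, hu.2])
  have i1 := intervalIntegral.integral_add_adjacent_intervals (a := 2 * T - V) (b := A) (c := U)
    ((hs.mono (Icc_subset_Icc_right hAU)).intervalIntegrable_of_Icc (μ := volume) hV)
    ((hs.mono (Icc_subset_Icc_left hV)).intervalIntegrable_of_Icc hAU)
  have i2 := intervalIntegral.integral_add_adjacent_intervals (a := 2 * T - V) (b := A) (c := U)
    ((hb.mono (Icc_subset_Icc_right hAU)).intervalIntegrable_of_Icc (μ := volume) hV)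
    ((hb.mono (Icc_subset_Icc_left hV)).intervalIntegrable_of_Icc hAU)
  linarith

/-- The energy on the slice exterior to a light cone does not increase in time. -/
theorem integral_slice_anti (h : IsNullPair α β ℓ C) {T T' U V : ℝ} (hT : 0 < T) (hTT : T ≤ T')
    (hU : U < T) (hV : 2 * T' - V ≤ U) :
    ∫ u in (2 * T' - V)..U, (α u (2 * T' - u) + β u (2 * T' - u)) ≤
      ∫ u in (2 * T - V)..U, (α u (2 * T - u) + β u (2 * T - u)) := by
  rw [h.integral_slice_eq hT hU (by linarith), h.integral_slice_eq (by linarith)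
    (hU.trans_le hTT) hV]
  have hα : ∀ v, 2 * T - U ≤ v → (U, v) ∈ nullQuadrant := fun v hv => by
    constructor <;> simp only <;> linarith
  have hβ : ∀ u ∈ Icc (2 * T - V) U, (u, V) ∈ nullQuadrant := fun u hu => by
    constructor <;> simp only <;> linarith [hu.1, hu.2]
  have m1 : ∫ v in (2 * T' - U)..V, α U v ≤ ∫ v in (2 * T - U)..V, α U v := by
    refine intervalIntegral.integral_mono_interval (by linarith) (by linarith) le_rfl ?_ ?_
    · filter_upwards [ae_restrict_mem measurableSet_Ioc] with v hv
      exact h.nonneg_left U v (hα v hv.1.le)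
    · exact (h.continuousOn_left_row (fun v hv => hα v hv.1)).intervalIntegrable_of_Icc
        (by linarith)
  have m2 : ∫ u in (2 * T' - V)..U, β u V ≤ ∫ u in (2 * T - V)..U, β u V := by
    refine intervalIntegral.integral_mono_interval (by linarith) hV le_rfl ?_ ?_
    · filter_upwards [ae_restrict_mem measurableSet_Ioc] with u hu
      exact h.nonneg_right u V (hβ u (Ioc_subset_Icc_self hu))
    · exact (h.continuousOn_right_column hβ).intervalIntegrable_of_Icc (by linarith)
  linarith

/-- The energy on every time slice is at most `E`. -/
def EnergyLE (α β : ℝ → ℝ → ℝ) (E : ℝ) : Prop :=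
  ∀ T U V, 0 < T → U < T → 2 * T - V ≤ U →
    ∫ u in (2 * T - V)..U, (α u (2 * T - u) + β u (2 * T - u)) ≤ E

variable {E : ℝ}

theorem flux_left_le (h : IsNullPair α β ℓ C) (hE : EnergyLE α β E) {U V : ℝ} (hU : 0 ≤ U)
    (hV : U + 2 ≤ V) : ∫ v in (U + 2)..V, α U v ≤ E := by
  have e := hE (U + 1) U V (by linarith) (by linarith) (by linarith)
  rw [h.integral_slice_eq (by linarith) (by linarith) (by linarith)] at e
  have : 0 ≤ ∫ u in (2 * (U + 1) - V)..U, β u V :=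
    intervalIntegral.integral_nonneg (by linarith) (fun u hu => h.nonneg_right u V (by
      constructor <;> simp only <;> linarith [hu.1, hu.2]))
  rw [show 2 * (U + 1) - U = U + 2 by ring] at e
  linarith

theorem flux_right_le (h : IsNullPair α β ℓ C) (hE : EnergyLE α β E) {U V : ℝ} (hU : 0 ≤ U)
    (hV : 2 * U + 2 ≤ V) : ∫ u in 0..U, β u V ≤ E := by
  have e := hE (U + 1) U V (by linarith) (by linarith) (by linarith)
  rw [h.integral_slice_eq (by linarith) (by linarith) (by linarith)] at e
  have h1 : 0 ≤ ∫ v in (2 * (U + 1) - U)..V, α U v :=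
    intervalIntegral.integral_nonneg (by linarith) (fun v hv => h.nonneg_left U v (by
      constructor <;> simp only <;> linarith [hv.1, hv.2]))
  have hm : ∀ u ∈ Icc (2 * (U + 1) - V) U, (u, V) ∈ nullQuadrant := fun u hu => by
    constructor <;> simp only <;> linarith [hu.1, hu.2]
  have h2 : ∫ u in 0..U, β u V ≤ ∫ u in (2 * (U + 1) - V)..U, β u V := by
    refine intervalIntegral.integral_mono_interval (by linarith) hU le_rfl ?_ ?_
    · filter_upwards [ae_restrict_mem measurableSet_Ioc] with u hu
      exact h.nonneg_right u V (hm u (Ioc_subset_Icc_self hu))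
    · exact (h.continuousOn_right_column hm).intervalIntegrable_of_Icc (by linarith)
  linarith

theorem intervalIntegrable_left (h : IsNullPair α β ℓ C) {U a b : ℝ} (hU : 0 ≤ U) (ha : U < a)
    (hab : a ≤ b) : IntervalIntegrable (fun v => α U v) volume a b :=
  (h.continuousOn_left_row (fun v hv => by
    constructor <;> simp only <;> linarith [hv.1])).intervalIntegrable_of_Icc hab

theorem flux_left_mono (h : IsNullPair α β ℓ C) {U a b c : ℝ} (hU : 0 ≤ U) (ha : U < a)
    (hab : a ≤ b) (hbc : b ≤ c) : ∫ v in a..b, α U v ≤ ∫ v in a..c, α U v := by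
  refine intervalIntegral.integral_mono_interval le_rfl hab hbc ?_
    (h.intervalIntegrable_left hU ha (hab.trans hbc))
  filter_upwards [ae_restrict_mem measurableSet_Ioc] with v hv
  exact h.nonneg_left U v (by constructor <;> simp only <;> linarith [hv.1])

/-- The total flux through an outgoing light cone is finite. -/
theorem exists_tendsto_flux_left (h : IsNullPair α β ℓ C) (hE : EnergyLE α β E) {U : ℝ}
    (hU : 0 ≤ U) : ∃ l, Tendsto (fun V => ∫ v in (U + 2)..V, α U v) atTop (nhds l) := by
  have hmono : Monotone fun V => ∫ v in (U + 2)..(max (U + 2) V), α U v := fun V V' hVV =>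
    h.flux_left_mono hU (by linarith) (le_max_left _ _) (max_le_max_left _ hVV)
  have hbdd : BddAbove (range fun V => ∫ v in (U + 2)..(max (U + 2) V), α U v) := by
    refine ⟨E, ?_⟩
    rintro _ ⟨V, rfl⟩
    exact h.flux_left_le hE hU (le_max_left _ _)
  refine ⟨_, (tendsto_atTop_ciSup hmono hbdd).congr' ?_⟩
  filter_upwards [eventually_ge_atTop (U + 2)] with V hV
  rw [max_eq_right hV]

theorem eventually_flux_left_le (h : IsNullPair α β ℓ C) (hE : EnergyLE α β E) {U η : ℝ}
    (hU : 0 ≤ U) (hη : 0 < η) :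
    ∀ᶠ V₀ in atTop, ∀ V, V₀ ≤ V → ∫ v in V₀..V, α U v ≤ η := by
  obtain ⟨l, hl⟩ := h.exists_tendsto_flux_left hE hU
  have hle : ∀ V, U + 2 ≤ V → ∫ v in (U + 2)..V, α U v ≤ l := fun V hV => by
    refine ge_of_tendsto hl ?_
    filter_upwards [eventually_ge_atTop V] with V' hV'
    exact h.flux_left_mono hU (by linarith) hV hV'
  filter_upwards [eventually_ge_atTop (U + 2), hl.eventually (eventually_gt_nhds
    (show l - η < l by linarith))] with V₀ hV₀ hlt V hV
  have := intervalIntegral.integral_add_adjacent_intervals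
    (h.intervalIntegrable_left hU (by linarith) hV₀)
    (h.intervalIntegrable_left hU (by linarith) hV)
  linarith [hle V (hV₀.trans hV)]

/-- Existence of the energy radiated along incoming cones. -/
theorem exists_tendsto_flux_right (h : IsNullPair α β ℓ C) (hE : EnergyLE α β E) {U : ℝ}
    (hU : 0 ≤ U) : ∃ l, Tendsto (fun V => ∫ u in 0..U, β u V) atTop (nhds l) := by
  obtain ⟨l, hl⟩ := h.exists_tendsto_flux_left hE hU
  obtain ⟨m, hm⟩ := h.exists_tendsto_flux_left hE le_rfl
  refine ⟨_, Tendsto.congr' ?_ ((tendsto_const_nhds (x := (∫ u in 0..U,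
    (α u (2 * (U + 1) - u) + β u (2 * (U + 1) - u))) -
      ∫ v in (0 + 2)..(2 * (U + 1)), α 0 v)).add (hm.sub hl))⟩
  filter_upwards [eventually_ge_atTop (2 * (U + 1))] with V hV
  have e := h.integral_slice_strip_eq (T := U + 1) (A := 0) (U := U) (V := V) (by linarith) hU
    (by linarith) (by linarith)
  have := intervalIntegral.integral_add_adjacent_intervals
    (h.intervalIntegrable_left le_rfl (a := 0 + 2) (b := 2 * (U + 1)) (by linarith) (by linarith))
    (h.intervalIntegrable_left le_rfl (b := V) (by linarith) hV)
  rw [sub_zero, show 2 * (U + 1) - U = U + 2 by ring] at e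
  linarith

theorem intervalIntegrable_right (h : IsNullPair α β ℓ C) {V a b : ℝ} (ha : 0 ≤ a) (hb : b < V)
    (hab : a ≤ b) : IntervalIntegrable (fun u => β u V) volume a b :=
  (h.continuousOn_right_column (fun u hu => by
    constructor <;> simp only <;> linarith [hu.1, hu.2])).intervalIntegrable_of_Icc hab

/-- The energy radiated after the cone `u = A` is small, for large `A`. -/
theorem exists_flux_right_le (h : IsNullPair α β ℓ C) (hE : EnergyLE α β E) {η : ℝ}
    (hη : 0 < η) : ∃ A₀ > 0, ∀ A U, A₀ ≤ A → A ≤ U →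
      ∀ᶠ V in atTop, ∫ u in A..U, β u V ≤ η := by
  have hex : ∀ U : ℝ, ∃ l, 0 ≤ U → Tendsto (fun V => ∫ u in 0..U, β u V) atTop (nhds l) :=
    fun U => by
      by_cases hU : 0 ≤ U
      · obtain ⟨l, hl⟩ := h.exists_tendsto_flux_right hE hU
        exact ⟨l, fun _ => hl⟩
      · exact ⟨0, fun h => absurd h hU⟩
  choose Φ hΦ using hex
  have hle : ∀ U, 0 ≤ U → Φ U ≤ E := fun U hU => by
    refine le_of_tendsto (hΦ U hU) ?_
    filter_upwards [eventually_ge_atTop (2 * U + 2)] with V hV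
    exact h.flux_right_le hE hU hV
  have hne : (Φ '' Ici 0).Nonempty := ⟨Φ 0, 0, self_mem_Ici, rfl⟩
  have hbdd : BddAbove (Φ '' Ici 0) := ⟨E, by rintro _ ⟨U, hU, rfl⟩; exact hle U hU⟩
  obtain ⟨_, ⟨A₁, hA₁, rfl⟩, hlt⟩ := exists_lt_of_lt_csSup hne
    (show sSup (Φ '' Ici 0) - η < sSup (Φ '' Ici 0) by linarith)
  have hA₁' : 0 ≤ A₁ := hA₁
  have hlim : ∀ a b, 0 ≤ a → a ≤ b →
      Tendsto (fun V => ∫ u in a..b, β u V) atTop (nhds (Φ b - Φ a)) := fun a b ha hab => by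
    refine ((hΦ b (ha.trans hab)).sub (hΦ a ha)).congr' ?_
    filter_upwards [eventually_gt_atTop b] with V hV
    rw [← intervalIntegral.integral_add_adjacent_intervals
      (h.intervalIntegrable_right le_rfl (hab.trans_lt hV) ha)
      (h.intervalIntegrable_right ha hV hab)]
    ring
  refine ⟨A₁ + 1, by linarith, fun A U hA hAU => ?_⟩
  have hmono : Φ A₁ ≤ Φ A := by
    have : 0 ≤ Φ A - Φ A₁ := by
      refine ge_of_tendsto (hlim A₁ A hA₁' (by linarith)) ?_
      filter_upwards [eventually_gt_atTop A] with V hV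
      exact intervalIntegral.integral_nonneg (by linarith) (fun u hu => h.nonneg_right u V (by
        constructor <;> simp only <;> linarith [hu.1, hu.2]))
    linarith
  have hU : Φ U ≤ sSup (Φ '' Ici 0) :=
    le_csSup hbdd ⟨U, show (0 : ℝ) ≤ U by linarith, rfl⟩
  exact ((hlim A U (by linarith) hAU).eventually (eventually_lt_nhds
    (show Φ U - Φ A < η by linarith))).mono fun _ hV => hV.le

/-- Energy decay in the self-similar region `λt ≤ r ≤ t - A`. -/
theorem exists_slice_le (h : IsNullPair α β ℓ C) (hC : 0 ≤ C) (hE : EnergyLE α β E)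
    {lam δ : ℝ} (hlam0 : 0 < lam) (hlam1 : lam < 1) (hδ : 0 < δ) :
    ∃ A₀ > 0, ∀ A, A₀ ≤ A → ∀ᶠ t in atTop,
      ∫ u in A..((1 - lam) * t), (α u (2 * t - u) + β u (2 * t - u)) ≤ δ := by
  set K : ℝ := Real.exp (9 * C * (1 - lam) / (8 * lam)) with hK
  have hK0 : 0 < K := Real.exp_pos _
  set η : ℝ := δ / (2 * K) with hη
  set μ : ℝ := δ / (2 * (2 * K + 1)) with hμ
  have hη0 : 0 < η := by positivity
  have hμ0 : 0 < μ := by positivity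
  obtain ⟨A₀, hA₀, hflux⟩ := h.exists_flux_right_le hE hμ0
  refine ⟨A₀, hA₀, fun A hA => ?_⟩
  have hA0 : 0 ≤ A := by linarith
  have htend : Tendsto (fun t : ℝ => (1 + lam) * t) atTop atTop :=
    tendsto_id.const_mul_atTop (by linarith)
  have htend' : Tendsto (fun t : ℝ => (1 - lam) * t) atTop atTop :=
    tendsto_id.const_mul_atTop (by linarith)
  filter_upwards [htend.eventually (h.eventually_flux_left_le hE hA0 hη0),
    htend'.eventually (eventually_ge_atTop A), eventually_gt_atTop 0] with t hleft hAt ht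
  have hlt : 0 < lam * t := by positivity
  obtain ⟨V, hV1, hV2⟩ := ((hflux A ((1 - lam) * t) hA hAt).and
    (eventually_ge_atTop (2 * t))).exists
  have hV0 : (1 + lam) * t ≤ V := by nlinarith
  have rect := h.flux_le_of_rectangle hC hA0 hAt hV0 (M := 2 * lam * t) (by positivity)
    (by linarith)
  have hexp : 9 * C / (4 * (2 * lam * t)) * ((1 - lam) * t) = 9 * C * (1 - lam) / (8 * lam) := by
    field_simp; ring
  rw [hexp, Real.exp_neg, ← hK] at rect
  have strip := h.integral_slice_strip_eq ht hAt (show (1 - lam) * t < t by linarith)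
    (show 2 * t - V ≤ A by linarith)
  rw [show 2 * t - (1 - lam) * t = (1 + lam) * t by ring] at strip
  have hnn : 0 ≤ ∫ v in (2 * t - A)..V, α A v :=
    intervalIntegral.integral_nonneg (by linarith) (fun v hv => h.nonneg_left A v (by
      constructor <;> simp only <;> linarith [hv.1, hv.2]))
  have rect' : ∫ v in ((1 + lam) * t)..V, α ((1 - lam) * t) v ≤ K * (η + 2 * μ) := by
    have := mul_le_mul_of_nonneg_left (rect.trans (add_le_add (hleft V hV0)
      (mul_le_mul_of_nonneg_left hV1 zero_le_two))) hK0.le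
    rwa [← mul_assoc, mul_inv_cancel₀ hK0.ne', one_mul] at this
  have e1 : K * η = δ / 2 := by rw [hη]; field_simp
  have e2 : (2 * K + 1) * μ = δ / 2 := by rw [hμ]; field_simp
  linarith

end IsNullPair
/-- Second-order differential data of a wave map at an interior point. -/
theorem IsWaveMap.exists_hasFDerivAt {ψ : ℝ → ℝ → ℝ} (hwm : IsWaveMap ψ) {t r : ℝ} (ht : 0 < t)
    (hr : 0 < r) :
    HasFDerivAt (fun p : ℝ × ℝ => ψ p.1 p.2)
      (pT ψ t r • ContinuousLinearMap.fst ℝ ℝ ℝ + pR ψ t r • ContinuousLinearMap.snd ℝ ℝ ℝ)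
      (t, r) ∧
    ∃ x y z : ℝ,
      HasFDerivAt (fun p : ℝ × ℝ => pT ψ p.1 p.2)
        (x • ContinuousLinearMap.fst ℝ ℝ ℝ + y • ContinuousLinearMap.snd ℝ ℝ ℝ) (t, r) ∧
      HasFDerivAt (fun p : ℝ × ℝ => pR ψ p.1 p.2)
        (y • ContinuousLinearMap.fst ℝ ℝ ℝ + z • ContinuousLinearMap.snd ℝ ℝ ℝ) (t, r) ∧
      x - z - (1 / r) * pR ψ t r + Real.sin (2 * ψ t r) / (2 * r ^ 2) = 0 := by
  set Ψ : ℝ × ℝ → ℝ := fun p => ψ p.1 p.2 with hΨ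
  have hsm : ∀ p : ℝ × ℝ, 0 < p.1 → 0 < p.2 → ContDiffAt ℝ (⊤ : ℕ∞) Ψ p := fun p h1 h2 =>
    hwm.1.contDiffAt (prod_mem_nhds (Ici_mem_nhds h1) (Ioi_mem_nhds h2))
  have hlin : ∀ L : ℝ × ℝ →L[ℝ] ℝ,
      L = L (1, 0) • ContinuousLinearMap.fst ℝ ℝ ℝ + L (0, 1) • ContinuousLinearMap.snd ℝ ℝ ℝ :=
    fun L => by ext <;> simp
  have hpart : ∀ (F : ℝ × ℝ → ℝ) (L : ℝ × ℝ →L[ℝ] ℝ) (p : ℝ × ℝ), HasFDerivAt F L p →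
      HasDerivAt (fun s => F (s, p.2)) (L (1, 0)) p.1 ∧
      HasDerivAt (fun s => F (p.1, s)) (L (0, 1)) p.2 := fun F L p hF => by
    constructor
    · exact hF.comp_hasDerivAt_of_eq p.1
        ((hasDerivAt_id p.1).prodMk (hasDerivAt_const p.1 p.2)) rfl
    · exact hF.comp_hasDerivAt_of_eq p.2
        ((hasDerivAt_const p.2 p.1).prodMk (hasDerivAt_id p.2)) rfl
  have hΨd : ∀ p : ℝ × ℝ, 0 < p.1 → 0 < p.2 → HasFDerivAt Ψ (fderiv ℝ Ψ p) p :=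
    fun p h1 h2 => ((hsm p h1 h2).differentiableAt (by simp)).hasFDerivAt
  have hT : ∀ p : ℝ × ℝ, 0 < p.1 → 0 < p.2 → pT ψ p.1 p.2 = fderiv ℝ Ψ p (1, 0) :=
    fun p h1 h2 => (hpart Ψ _ p (hΨd p h1 h2)).1.deriv
  have hR : ∀ p : ℝ × ℝ, 0 < p.1 → 0 < p.2 → pR ψ p.1 p.2 = fderiv ℝ Ψ p (0, 1) :=
    fun p h1 h2 => (hpart Ψ _ p (hΨd p h1 h2)).2.deriv
  have hnhds : ∀ᶠ p : ℝ × ℝ in nhds (t, r), 0 < p.1 ∧ 0 < p.2 :=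
    (isOpen_Ioi.prod isOpen_Ioi).mem_nhds (show (t, r) ∈ Ioi (0 : ℝ) ×ˢ Ioi (0 : ℝ) from ⟨ht, hr⟩)
  have hcd := hsm (t, r) ht hr
  have hdd : HasFDerivAt (fderiv ℝ Ψ) (fderiv ℝ (fderiv ℝ Ψ) (t, r)) (t, r) := by
    refine DifferentiableAt.hasFDerivAt ?_
    exact (hcd.fderiv_right (m := 1) (by norm_cast)).differentiableAt (by simp)
  have hsymm : IsSymmSndFDerivAt ℝ Ψ (t, r) :=
    hcd.isSymmSndFDerivAt (by rw [minSmoothness_of_isRCLikeNormedField]; norm_cast)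
  set B := fderiv ℝ (fderiv ℝ Ψ) (t, r) with hB
  have hTd : HasFDerivAt (fun p : ℝ × ℝ => pT ψ p.1 p.2) (B.flip (1, 0)) (t, r) := by
    refine (hdd.clm_apply (hasFDerivAt_const ((1 : ℝ), (0 : ℝ)) (t, r))).congr_of_eventuallyEq
      (hnhds.mono fun p hp => hT p hp.1 hp.2) |>.congr_fderiv ?_
    ext <;> simp
  have hRd : HasFDerivAt (fun p : ℝ × ℝ => pR ψ p.1 p.2) (B.flip (0, 1)) (t, r) := by
    refine (hdd.clm_apply (hasFDerivAt_const ((0 : ℝ), (1 : ℝ)) (t, r))).congr_of_eventuallyEq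
      (hnhds.mono fun p hp => hR p hp.1 hp.2) |>.congr_fderiv ?_
    ext <;> simp
  have hxy : B.flip (1, 0) (0, 1) = B.flip (0, 1) (1, 0) := hsymm.eq (0, 1) (1, 0)
  refine ⟨?_, B.flip (1, 0) (1, 0), B.flip (1, 0) (0, 1), B.flip (0, 1) (0, 1),
    hTd.congr_fderiv (hlin _), hRd.congr_fderiv ?_, ?_⟩
  · have h := hΨd (t, r) ht hr
    rw [hlin (fderiv ℝ Ψ (t, r)), ← hT (t, r) ht hr, ← hR (t, r) ht hr] at h
    exact h
  · rw [hxy]; exact hlin _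
  · have h := hwm.2 t r ht.le hr
    rw [(hpart _ _ (t, r) hTd).1.deriv, (hpart _ _ (t, r) hRd).2.deriv] at h
    exact h

/-- The null energy density `r ((∂ₜψ + ∂ᵣψ)² + sin²ψ/r²)` in coordinates `u = t-r`, `v = t+r`. -/
def nullLeft (ψ : ℝ → ℝ → ℝ) (u v : ℝ) : ℝ :=
  ((pT ψ ((u + v) / 2) ((v - u) / 2) + pR ψ ((u + v) / 2) ((v - u) / 2)) ^ 2 +
    (Real.sin (ψ ((u + v) / 2) ((v - u) / 2))) ^ 2 / ((v - u) / 2) ^ 2) * ((v - u) / 2)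

/-- The null energy density `r ((∂ₜψ - ∂ᵣψ)² + sin²ψ/r²)` in coordinates `u = t-r`, `v = t+r`. -/
def nullRight (ψ : ℝ → ℝ → ℝ) (u v : ℝ) : ℝ :=
  ((pT ψ ((u + v) / 2) ((v - u) / 2) - pR ψ ((u + v) / 2) ((v - u) / 2)) ^ 2 +
    (Real.sin (ψ ((u + v) / 2) ((v - u) / 2))) ^ 2 / ((v - u) / 2) ^ 2) * ((v - u) / 2)

/-- The rate at which the two null energy densities exchange energy. -/
def nullExchange (ψ : ℝ → ℝ → ℝ) (u v : ℝ) : ℝ :=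
  ((pR ψ ((u + v) / 2) ((v - u) / 2)) ^ 2 - (pT ψ ((u + v) / 2) ((v - u) / 2)) ^ 2 +
    (Real.sin (ψ ((u + v) / 2) ((v - u) / 2))) ^ 2 / ((v - u) / 2) ^ 2 -
    4 * pR ψ ((u + v) / 2) ((v - u) / 2) * Real.sin (ψ ((u + v) / 2) ((v - u) / 2)) *
      Real.cos (ψ ((u + v) / 2) ((v - u) / 2)) / ((v - u) / 2)) / 2

theorem IsWaveMap.isNullPair {ψ : ℝ → ℝ → ℝ} (hwm : IsWaveMap ψ) :
    IsNullPair (nullLeft ψ) (nullRight ψ) (nullExchange ψ) 24 := by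
  have hpos : ∀ p : ℝ × ℝ, p ∈ nullQuadrant → 0 < (p.1 + p.2) / 2 ∧ 0 < (p.2 - p.1) / 2 :=
    fun p hp => ⟨by linarith [hp.1], by linarith [hp.2]⟩
  have hmap : ContinuousOn (fun p : ℝ × ℝ => ((p.1 + p.2) / 2, (p.2 - p.1) / 2)) nullQuadrant := by
    fun_prop
  have hmaps : MapsTo (fun p : ℝ × ℝ => ((p.1 + p.2) / 2, (p.2 - p.1) / 2)) nullQuadrant
      (Ioi (0 : ℝ) ×ˢ Ioi (0 : ℝ)) := fun p hp => hpos p hp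
  have hc0 : ContinuousOn (fun p : ℝ × ℝ => ψ ((p.1 + p.2) / 2) ((p.2 - p.1) / 2))
      nullQuadrant :=
    (show ContinuousOn (fun p : ℝ × ℝ => ψ p.1 p.2) (Ioi (0 : ℝ) ×ˢ Ioi (0 : ℝ)) from
      fun p hp => (hwm.exists_hasFDerivAt hp.1 hp.2).1.continuousAt.continuousWithinAt).comp
        hmap hmaps
  have hcT : ContinuousOn (fun p : ℝ × ℝ => pT ψ ((p.1 + p.2) / 2) ((p.2 - p.1) / 2))
      nullQuadrant :=
    (show ContinuousOn (fun p : ℝ × ℝ => pT ψ p.1 p.2) (Ioi (0 : ℝ) ×ˢ Ioi (0 : ℝ)) from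
      fun p hp => by
        obtain ⟨-, x, y, z, h, -, -⟩ := hwm.exists_hasFDerivAt hp.1 hp.2
        exact h.continuousAt.continuousWithinAt).comp hmap hmaps
  have hcR : ContinuousOn (fun p : ℝ × ℝ => pR ψ ((p.1 + p.2) / 2) ((p.2 - p.1) / 2))
      nullQuadrant :=
    (show ContinuousOn (fun p : ℝ × ℝ => pR ψ p.1 p.2) (Ioi (0 : ℝ) ×ˢ Ioi (0 : ℝ)) from
      fun p hp => by
        obtain ⟨-, x, y, z, -, h, -⟩ := hwm.exists_hasFDerivAt hp.1 hp.2
        exact h.continuousAt.continuousWithinAt).comp hmap hmaps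
  have hcs := Real.continuous_sin.comp_continuousOn hc0
  have hcc := Real.continuous_cos.comp_continuousOn hc0
  simp only [Function.comp_def] at hcs hcc
  have hcq : ContinuousOn (fun p : ℝ × ℝ =>
      (Real.sin (ψ ((p.1 + p.2) / 2) ((p.2 - p.1) / 2))) ^ 2 / ((p.2 - p.1) / 2) ^ 2)
      nullQuadrant :=
    (hcs.pow 2).div (by fun_prop) (fun p hp => pow_ne_zero 2 (hpos p hp).2.ne')
  refine ⟨?_, ?_, ?_, ?_, ?_, ?_, ?_, ?_⟩
  · simp only [nullLeft]
    exact (((hcT.add hcR).pow 2).add hcq).mul (by fun_prop)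
  · simp only [nullRight]
    exact (((hcT.sub hcR).pow 2).add hcq).mul (by fun_prop)
  · simp only [nullExchange]
    refine ContinuousOn.div_const (ContinuousOn.sub (((hcR.pow 2).sub (hcT.pow 2)).add hcq) ?_) 2
    exact (((hcR.const_mul 4).mul hcs).mul hcc).div (by fun_prop) (fun p hp => (hpos p hp).2.ne')
  · intro u v hp
    exact mul_nonneg (by positivity) (hpos _ hp).2.le
  · intro u v hp
    exact mul_nonneg (by positivity) (hpos _ hp).2.le
  · intro u v hp
    obtain ⟨ht, hr⟩ := hpos _ hp
    simp only at ht hr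
    obtain ⟨h0, x, y, z, h1, h2, heq⟩ := hwm.exists_hasFDerivAt ht hr
    have hγ : HasDerivAt (fun u : ℝ => ((u + v) / 2, (v - u) / 2)) (1 / 2, -1 / 2) u :=
      (((hasDerivAt_id u).add_const v).div_const 2).prodMk
        (((hasDerivAt_id u).const_sub v).div_const 2)
    have d0 := h0.comp_hasDerivAt_of_eq u hγ rfl
    have d1 := h1.comp_hasDerivAt_of_eq u hγ rfl
    have d2 := h2.comp_hasDerivAt_of_eq u hγ rfl
    have d3 : HasDerivAt (fun u : ℝ => (v - u) / 2) (-1 / 2) u :=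
      ((hasDerivAt_id u).const_sub v).div_const 2
    have key := ((((d1.add d2).pow 2).add ((d0.sin.pow 2).div (d3.pow 2)
      (pow_ne_zero 2 hr.ne'))).mul d3)
    refine (key.congr_deriv ?_)
    simp only [nullExchange, Pi.add_apply, Pi.pow_apply, Pi.div_apply, Function.comp_apply]
    generalize (v - u) / 2 = r at *
    generalize (u + v) / 2 = t at *
    have hx : x = z + (1 / r) * pR ψ t r - Real.sin (2 * ψ t r) / (2 * r ^ 2) := by linarith
    rw [hx, Real.sin_two_mul]
    simp
    field_simp
    ring
  · intro u v hp
    obtain ⟨ht, hr⟩ := hpos _ hp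
    simp only at ht hr
    obtain ⟨h0, x, y, z, h1, h2, heq⟩ := hwm.exists_hasFDerivAt ht hr
    have hγ : HasDerivAt (fun v : ℝ => ((u + v) / 2, (v - u) / 2)) (1 / 2, 1 / 2) v :=
      (((hasDerivAt_id v).const_add u).div_const 2).prodMk
        (((hasDerivAt_id v).sub_const u).div_const 2)
    have d0 := h0.comp_hasDerivAt_of_eq v hγ rfl
    have d1 := h1.comp_hasDerivAt_of_eq v hγ rfl
    have d2 := h2.comp_hasDerivAt_of_eq v hγ rfl
    have d3 : HasDerivAt (fun v : ℝ => (v - u) / 2) (1 / 2) v :=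
      ((hasDerivAt_id v).sub_const u).div_const 2
    have key := ((((d1.sub d2).pow 2).add ((d0.sin.pow 2).div (d3.pow 2)
      (pow_ne_zero 2 hr.ne'))).mul d3)
    refine (key.congr_deriv ?_)
    simp only [nullExchange, Pi.add_apply, Pi.sub_apply, Pi.pow_apply, Pi.div_apply,
      Function.comp_apply]
    generalize (v - u) / 2 = r at *
    generalize (u + v) / 2 = t at *
    have hx : x = z + (1 / r) * pR ψ t r - Real.sin (2 * ψ t r) / (2 * r ^ 2) := by linarith
    rw [hx, Real.sin_two_mul]
    simp
    field_simp
    ring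
  · intro u v hp
    have hr : 0 < (v - u) / 2 := (hpos _ hp).2
    have hvu : v - u = 2 * ((v - u) / 2) := by ring
    simp only [nullExchange, nullLeft, nullRight]
    rw [show (v - u) ^ 2 = 4 * ((v - u) / 2) ^ 2 by ring]
    generalize (v - u) / 2 = r at *
    generalize (u + v) / 2 = t at *
    generalize pT ψ t r = a
    generalize pR ψ t r = b
    have hc : Real.cos (ψ t r) ^ 2 ≤ 1 := Real.cos_sq_le_one _
    have hs : ∃ s, Real.sin (ψ t r) = s * r := ⟨Real.sin (ψ t r) / r, by field_simp⟩
    obtain ⟨s, hs⟩ := hs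
    rw [hs]
    generalize Real.cos (ψ t r) = c at *
    have e1 : (s * r) ^ 2 / r ^ 2 = s ^ 2 := by field_simp
    have e2 : 4 * b * (s * r) * c / r = 4 * b * s * c := by field_simp
    rw [e1, e2]
    have hb : (b * s * c) ^ 2 ≤ b ^ 2 * s ^ 2 := by
      nlinarith [mul_nonneg (sq_nonneg b) (sq_nonneg s)]
    have hmain : (b ^ 2 - a ^ 2 + s ^ 2 - 4 * b * s * c) ^ 2 ≤
        24 * (((a + b) ^ 2 + s ^ 2) * ((a - b) ^ 2 + s ^ 2)) := by
      nlinarith [sq_nonneg (b ^ 2 - a ^ 2 - s ^ 2), sq_nonneg (b ^ 2 - a ^ 2 + 4 * b * s * c),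
        sq_nonneg (s ^ 2 + 4 * b * s * c), mul_nonneg (sq_nonneg a) (sq_nonneg s),
        sq_nonneg (s ^ 2), sq_nonneg (b ^ 2 - a ^ 2), mul_nonneg (sq_nonneg b) (sq_nonneg s)]
    nlinarith [mul_le_mul_of_nonneg_right hmain (sq_nonneg r)]

theorem nullLeft_add_nullRight (ψ : ℝ → ℝ → ℝ) (T u : ℝ) :
    nullLeft ψ u (2 * T - u) + nullRight ψ u (2 * T - u) = 2 * eDen ψ T (T - u) := by
  simp only [nullLeft, nullRight, eDen]
  rw [show (u + (2 * T - u)) / 2 = T by ring, show (2 * T - u - u) / 2 = T - u by ring]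
  ring

theorem integral_slice_eq_integral_eDen (ψ : ℝ → ℝ → ℝ) (T a b : ℝ) :
    ∫ u in a..b, (nullLeft ψ u (2 * T - u) + nullRight ψ u (2 * T - u)) =
      2 * ∫ r in (T - b)..(T - a), eDen ψ T r := by
  simp only [nullLeft_add_nullRight]
  rw [intervalIntegral.integral_const_mul, intervalIntegral.integral_comp_sub_left (eDen ψ T)]

/-- The energy of a finite interval of radii is at most that of a half-line containing it. -/
theorem FiniteEnergy.integral_le {ψ : ℝ → ℝ → ℝ} (hfe : FiniteEnergy ψ) {t a b c : ℝ}
    (ht : 0 ≤ t) (hc : 0 ≤ c) (hca : c ≤ a) (hab : a ≤ b) :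
    ∫ r in a..b, eDen ψ t r ≤ ∫ r in Ioi c, eDen ψ t r := by
  rw [intervalIntegral.integral_of_le hab]
  refine setIntegral_mono_set ((hfe t ht).mono_set (Ioi_subset_Ioi hc)) ?_ ?_
  · filter_upwards [ae_restrict_mem measurableSet_Ioi] with r hr
    exact eDen_nonneg ψ t (hc.trans (le_of_lt hr))
  · exact (show Ioc a b ⊆ Ioi c from fun r hr => hca.trans_lt hr.1).eventuallyLE

theorem energyLE_of_conserved {ψ : ℝ → ℝ → ℝ} (hfe : FiniteEnergy ψ) (hcons : EnergyConserved ψ) :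
    IsNullPair.EnergyLE (nullLeft ψ) (nullRight ψ) (2 * totE ψ 0) := by
  intro T U V hT hU hV
  rw [integral_slice_eq_integral_eDen, ← hcons T hT.le]
  have := hfe.integral_le hT.le le_rfl (show 0 ≤ T - U by linarith)
    (show T - U ≤ T - (2 * T - V) by linarith)
  unfold totE
  linarith

/-- The energy outside a sufficiently wide forward light cone is small, uniformly in time. -/
theorem IsWaveMap.exists_exterior_energy_le {ψ : ℝ → ℝ → ℝ} (hwm : IsWaveMap ψ)
    (hfe : FiniteEnergy ψ) {η : ℝ} (hη : 0 < η) :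
    ∃ R > 0, ∀ t b, 1 ≤ t → t + R ≤ b → ∫ r in (t + R)..b, eDen ψ t r ≤ η := by
  have hlim : Tendsto (fun R : ℝ => ∫ r in Ioi (1 + R), eDen ψ 1 r) atTop (nhds 0) := by
    have h1 := tendsto_setIntegral_of_antitone (f := eDen ψ 1) (μ := volume)
      (s := fun R : ℝ => Ioi (1 + R)) (fun _ => measurableSet_Ioi)
      (fun a b hab => Ioi_subset_Ioi (by linarith))
      ⟨0, (hfe 1 zero_le_one).mono_set (Ioi_subset_Ioi (by norm_num))⟩
    have h2 : (⋂ R : ℝ, Ioi (1 + R)) = ∅ := by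
      ext x
      simp only [mem_iInter, mem_Ioi, mem_empty_iff_false, iff_false, not_forall]
      exact ⟨x, by linarith⟩
    rwa [h2, setIntegral_empty] at h1
  obtain ⟨R, hR, hR0⟩ := ((hlim.eventually (eventually_lt_nhds hη)).and
    (eventually_gt_atTop 0)).exists
  refine ⟨R, hR0, fun t b ht hb => ?_⟩
  have h := hwm.isNullPair.integral_slice_anti (T := 1) (T' := t) (U := -R) (V := b + t)
    one_pos ht (by linarith) (by linarith)
  rw [integral_slice_eq_integral_eDen, integral_slice_eq_integral_eDen,
    show t - -R = t + R by ring, show t - (2 * t - (b + t)) = b by ring] at h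
  have h3 := hfe.integral_le (t := 1) (a := 1 - -R) (b := 1 - (2 * 1 - (b + t))) (c := 1 + R)
    zero_le_one (by linarith) (by linarith) (by linarith)
  linarith

/-- The oscillation of a function over `[a, b]` is controlled by its radial Dirichlet energy. -/
theorem abs_sub_le_of_energy {f f' : ℝ → ℝ} {a b I s : ℝ} (ha : 0 < a) (hab : a ≤ b) (hs : 0 < s)
    (hf : ∀ r ∈ Icc a b, HasDerivAt f (f' r) r) (hf' : ContinuousOn f' (Icc a b))
    (hI : ∫ r in a..b, f' r ^ 2 * r ≤ I) :
    |f b - f a| ≤ I / (2 * s) + s * (b - a) / (2 * a) := by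
  have h1 : f b - f a = ∫ r in a..b, f' r :=
    (intervalIntegral.integral_eq_sub_of_hasDerivAt
      (fun r hr => hf r (by rwa [uIcc_of_le hab] at hr))
      (hf'.intervalIntegrable_of_Icc hab)).symm
  rw [h1]
  have hc : ContinuousOn (fun r => f' r ^ 2 * r) (Icc a b) := by fun_prop
  calc |∫ r in a..b, f' r| ≤ ∫ r in a..b, |f' r| :=
        intervalIntegral.abs_integral_le_integral_abs hab
    _ ≤ ∫ r in a..b, (1 / (2 * s) * (f' r ^ 2 * r) + s / (2 * a)) := by
        refine intervalIntegral.integral_mono_on hab (hf'.abs.intervalIntegrable_of_Icc hab)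
          (ContinuousOn.intervalIntegrable_of_Icc hab (by fun_prop)) (fun r hr => ?_)
        have h2 : f' r ^ 2 * a ≤ f' r ^ 2 * r := mul_le_mul_of_nonneg_left hr.1 (sq_nonneg _)
        have h3 : |f' r| ≤ 1 / (2 * s) * (f' r ^ 2 * a) + s / (2 * a) := by
          have : 1 / (2 * s) * (f' r ^ 2 * a) + s / (2 * a) - |f' r| =
              (|f' r| * a - s) ^ 2 / (2 * s * a) := by
            rw [← sq_abs (f' r)]; field_simp; ring
          have h4 : 0 ≤ (|f' r| * a - s) ^ 2 / (2 * s * a) := by positivity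
          linarith
        have h5 := mul_le_mul_of_nonneg_left h2 (show 0 ≤ 1 / (2 * s) by positivity)
        linarith
    _ = 1 / (2 * s) * (∫ r in a..b, f' r ^ 2 * r) + (b - a) * (s / (2 * a)) := by
        rw [intervalIntegral.integral_add
          ((hc.const_mul _).intervalIntegrable_of_Icc hab) intervalIntegrable_const,
          intervalIntegral.integral_const_mul, intervalIntegral.integral_const, smul_eq_mul]
    _ ≤ 1 / (2 * s) * I + (b - a) * (s / (2 * a)) := by gcongr
    _ = I / (2 * s) + s * (b - a) / (2 * a) := by ring

theorem one_sub_cos_le_abs_cos_sub_cos_int_mul_pi {x θ : ℝ} {k : ℤ} (hx : |x - k * Real.pi| = θ) :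
    1 - Real.cos θ ≤ |Real.cos x - Real.cos (k * Real.pi)| := by
  have h1 : Real.cos x = Real.cos (k * Real.pi) * Real.cos θ := by
    rw [← hx, Real.cos_abs, Real.cos_sub, Real.sin_int_mul_pi]
    have := Real.cos_sq_add_sin_sq (k * Real.pi)
    rw [Real.sin_int_mul_pi] at this
    linear_combination (-Real.cos x) * this
  have h2 : |Real.cos (k * Real.pi)| = 1 := Real.abs_cos_int_mul_pi k
  have h3 : Real.cos x - Real.cos (k * Real.pi) =
      Real.cos (k * Real.pi) * -(1 - Real.cos θ) := by rw [h1]; ring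
  rw [h3, abs_mul, h2, one_mul, abs_neg]
  exact le_abs_self _

/-- A function of small energy on `[R, ∞)` stays close to its limit `kπ`. -/
theorem abs_sub_int_mul_pi_lt_of_energy {f f' : ℝ → ℝ} {R θ : ℝ} {k : ℤ} (hR : 0 < R)
    (hθ : 0 < θ) (hθ' : θ ≤ Real.pi)
    (hf : ∀ r, R ≤ r → HasDerivAt f (f' r) r) (hf' : ContinuousOn f' (Ici R))
    (hlim : Tendsto f atTop (nhds (k * Real.pi)))
    (hI : ∀ b, R ≤ b →
      ∫ r in R..b, (f' r ^ 2 + Real.sin (f r) ^ 2 / r ^ 2) * r ≤ 1 - Real.cos θ)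
    {r : ℝ} (hr : R ≤ r) : |f r - k * Real.pi| < θ := by
  by_contra! hge
  have hfc : ContinuousOn f (Ici R) := fun x hx => (hf x hx).continuousAt.continuousWithinAt
  have hev : ∀ᶠ b in atTop, |f b - k * Real.pi| < θ := by
    have := (hlim.sub_const (k * Real.pi)).abs
    rw [sub_self, abs_zero] at this
    exact this.eventually (eventually_lt_nhds hθ)
  obtain ⟨b, hb, hrb⟩ := (hev.and (eventually_ge_atTop r)).exists
  have hsub : Icc r b ⊆ Ici R := fun x hx => hr.trans hx.1
  obtain ⟨x, hx, hxθ⟩ := intermediate_value_Icc' hrb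
    (((hfc.mono hsub).sub continuousOn_const).abs) ⟨hb.le, hge⟩
  have hRx : R ≤ x := hsub hx
  have hdc : ContinuousOn (fun y => (f' y ^ 2 + Real.sin (f y) ^ 2 / y ^ 2) * y) (Ici R) := by
    have : ContinuousOn (fun y => Real.sin (f y) ^ 2 / y ^ 2) (Ici R) :=
      (Real.continuous_sin.comp_continuousOn hfc).pow 2 |>.div (by fun_prop)
        (fun y hy => pow_ne_zero 2 (hR.trans_le hy).ne')
    fun_prop
  have hbound : ∀ c, x ≤ c → |Real.cos (f c) - Real.cos (f x)| ≤ (1 - Real.cos θ) / 2 := by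
    intro c hc
    have hsubc : Icc x c ⊆ Ici R := fun y hy => hRx.trans hy.1
    have hgc : ContinuousOn (fun y => -Real.sin (f y) * f' y) (Icc x c) :=
      ((Real.continuous_sin.comp_continuousOn hfc).neg.mul hf').mono hsubc
    rw [← intervalIntegral.integral_eq_sub_of_hasDerivAt (f := fun y => Real.cos (f y))
      (f' := fun y => -Real.sin (f y) * f' y)
      (fun y hy => (hf y (hsubc (by rwa [uIcc_of_le hc] at hy))).cos)
      (hgc.intervalIntegrable_of_Icc hc)]
    have hi1 := (hdc.mono hsubc).intervalIntegrable_of_Icc (μ := volume) hc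
    have h1 : |∫ y in x..c, -Real.sin (f y) * f' y| ≤
        ∫ y in x..c, 1 / 2 * ((f' y ^ 2 + Real.sin (f y) ^ 2 / y ^ 2) * y) := by
      refine (intervalIntegral.abs_integral_le_integral_abs hc).trans ?_
      refine intervalIntegral.integral_mono_on hc (hgc.abs.intervalIntegrable_of_Icc hc)
        (hi1.const_mul _) (fun y hy => ?_)
      have hy0 : 0 < y := hR.trans_le (hsubc hy)
      rw [abs_mul, abs_neg]
      have : 1 / 2 * ((f' y ^ 2 + Real.sin (f y) ^ 2 / y ^ 2) * y) - |Real.sin (f y)| * |f' y| =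
          (|f' y| * y - |Real.sin (f y)|) ^ 2 / (2 * y) := by
        rw [← sq_abs (f' y), ← sq_abs (Real.sin (f y))]; field_simp; ring
      have h4 : 0 ≤ (|f' y| * y - |Real.sin (f y)|) ^ 2 / (2 * y) := by positivity
      linarith
    have h2 : ∫ y in x..c, (f' y ^ 2 + Real.sin (f y) ^ 2 / y ^ 2) * y ≤
        ∫ y in R..c, (f' y ^ 2 + Real.sin (f y) ^ 2 / y ^ 2) * y := by
      refine intervalIntegral.integral_mono_interval hRx hc le_rfl ?_ ?_
      · filter_upwards [ae_restrict_mem measurableSet_Ioc] with y hy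
        exact mul_nonneg (by positivity) (hR.le.trans hy.1.le)
      · exact (hdc.mono fun y hy => hy.1).intervalIntegrable_of_Icc (hRx.trans hc)
    rw [intervalIntegral.integral_const_mul] at h1
    linarith [hI c (hRx.trans hc)]
  have hlimc : Tendsto (fun c => |Real.cos (f c) - Real.cos (f x)|) atTop
      (nhds |Real.cos (k * Real.pi) - Real.cos (f x)|) :=
    (((Real.continuous_cos.tendsto _).comp hlim).sub_const _).abs
  have h1 := le_of_tendsto hlimc ((eventually_ge_atTop x).mono hbound)
  have h2 := one_sub_cos_le_abs_cos_sub_cos_int_mul_pi hxθ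
  rw [abs_sub_comm] at h1
  have h3 : Real.cos θ < 1 := by
    have := Real.cos_lt_cos_of_nonneg_of_le_pi le_rfl hθ' hθ
    rwa [Real.cos_zero] at this
  linarith

theorem IsWaveMap.continuousOn_slice {ψ : ℝ → ℝ → ℝ} (hwm : IsWaveMap ψ) {t : ℝ} (ht : 0 < t) :
    ContinuousOn (ψ t) (Ioi 0) ∧ ContinuousOn (pT ψ t) (Ioi 0) ∧ ContinuousOn (pR ψ t) (Ioi 0) := by
  have hc : Continuous fun r : ℝ => (t, r) := by fun_prop
  refine ⟨fun r hr => ?_, fun r hr => ?_, fun r hr => ?_⟩ <;>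
    obtain ⟨h0, x, y, z, h1, h2, -⟩ := hwm.exists_hasFDerivAt ht hr
  · exact (h0.continuousAt.comp (f := fun r : ℝ => (t, r)) hc.continuousAt).continuousWithinAt
  · exact (h1.continuousAt.comp (f := fun r : ℝ => (t, r)) hc.continuousAt).continuousWithinAt
  · exact (h2.continuousAt.comp (f := fun r : ℝ => (t, r)) hc.continuousAt).continuousWithinAt

theorem IsWaveMap.hasDerivAt_slice {ψ : ℝ → ℝ → ℝ} (hwm : IsWaveMap ψ) {t r : ℝ} (ht : 0 < t)
    (hr : 0 < r) : HasDerivAt (ψ t) (pR ψ t r) r := by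
  have h := (hwm.exists_hasFDerivAt ht hr).1.comp_hasDerivAt_of_eq r
    ((hasDerivAt_const r t).prodMk (hasDerivAt_id r)) rfl
  refine HasDerivAt.congr_deriv (f := ψ t) h ?_
  simp

theorem IsWaveMap.continuousOn_eDen {ψ : ℝ → ℝ → ℝ} (hwm : IsWaveMap ψ) {t : ℝ} (ht : 0 < t) :
    ContinuousOn (eDen ψ t) (Ioi 0) := by
  obtain ⟨h0, h1, h2⟩ := hwm.continuousOn_slice ht
  refine (((h1.pow 2).add (h2.pow 2)).add ?_).mul continuousOn_id
  exact ((Real.continuous_sin.comp_continuousOn h0).pow 2).div (by fun_prop)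
    (fun r hr => pow_ne_zero 2 (ne_of_gt hr))

/-- Part of the energy density of a wave map is dominated by the full energy. -/
theorem IsWaveMap.integral_le_energy {ψ : ℝ → ℝ → ℝ} (hwm : IsWaveMap ψ) {t a b : ℝ} (ht : 0 < t)
    (ha : 0 < a) (hab : a ≤ b) {g : ℝ → ℝ} (hg : ContinuousOn g (Ioi 0))
    (hle : ∀ r, 0 < r → g r ≤ eDen ψ t r) :
    ∫ r in a..b, g r ≤ ∫ r in a..b, eDen ψ t r := by
  have hs : Icc a b ⊆ Ioi 0 := fun r hr => ha.trans_le hr.1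
  exact intervalIntegral.integral_mono_on hab ((hg.mono hs).intervalIntegrable_of_Icc hab)
    (((hwm.continuousOn_eDen ht).mono hs).intervalIntegrable_of_Icc hab)
    (fun r hr => hle r (hs hr))

/-- The oscillation of a wave map over an annulus is controlled by its energy there. -/
theorem IsWaveMap.abs_sub_le {ψ : ℝ → ℝ → ℝ} (hwm : IsWaveMap ψ) {t a b I s : ℝ} (ht : 0 < t)
    (ha : 0 < a) (hab : a ≤ b) (hs : 0 < s) (hI : ∫ r in a..b, eDen ψ t r ≤ I) :
    |ψ t b - ψ t a| ≤ I / (2 * s) + s * (b - a) / (2 * a) := by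
  have hc := (hwm.continuousOn_slice ht).2.2
  refine abs_sub_le_of_energy ha hab hs
    (fun r hr => hwm.hasDerivAt_slice ht (ha.trans_le hr.1))
    (hc.mono fun r hr => ha.trans_le hr.1) (le_trans ?_ hI)
  refine hwm.integral_le_energy ht ha hab ((hc.pow 2).mul continuousOn_id) (fun r hr => ?_)
  refine mul_le_mul_of_nonneg_right ?_ hr.le
  have : 0 ≤ (Real.sin (ψ t r)) ^ 2 / r ^ 2 := by positivity
  change pR ψ t r ^ 2 ≤ _
  nlinarith [sq_nonneg (pT ψ t r)]

/-- Outside a light cone `r = t - A`, a finite-energy wave map approaches its value at infinity. -/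
theorem IsWaveMap.eventually_abs_sub_int_mul_pi_le {ψ : ℝ → ℝ → ℝ} {k : ℤ} (hwm : IsWaveMap ψ)
    (hfe : FiniteEnergy ψ) (hcons : EnergyConserved ψ)
    (hbcinf : ∀ t : ℝ, 0 ≤ t → Tendsto (ψ t) atTop (nhds (k * Real.pi)))
    {A θ : ℝ} (hθ : 0 < θ) (hθ' : θ ≤ Real.pi) :
    ∀ᶠ t in atTop, |ψ t (t - A) - k * Real.pi| ≤ 2 * θ := by
  have hcos : 0 < 1 - Real.cos θ := by
    have := Real.cos_lt_cos_of_nonneg_of_le_pi le_rfl hθ' hθ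
    rw [Real.cos_zero] at this
    linarith
  obtain ⟨R, hR, hext⟩ := hwm.exists_exterior_energy_le hfe hcos
  set W : ℝ := max R (-A) with hW
  have hE0 : 0 ≤ totE ψ 0 :=
    setIntegral_nonneg measurableSet_Ioi fun r hr => eDen_nonneg ψ 0 (le_of_lt hr)
  set s : ℝ := (totE ψ 0 + 1) / θ with hs
  have hs0 : 0 < s := by positivity
  filter_upwards [eventually_ge_atTop 1, eventually_gt_atTop A,
    eventually_ge_atTop (A + s * (W + A) / θ)] with t ht htA hts
  have ht0 : 0 < t := by linarith
  have hRW : R ≤ W := le_max_left _ _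
  have hAW : -A ≤ W := le_max_right _ _
  have hc := hwm.continuousOn_slice ht0
  have hsub : ∀ r, t + R ≤ r → 0 < r := fun r hr => by linarith
  have hfar : |ψ t (t + W) - k * Real.pi| < θ := by
    refine abs_sub_int_mul_pi_lt_of_energy (f' := pR ψ t) (show 0 < t + R by linarith) hθ hθ'
      (fun r hr => hwm.hasDerivAt_slice ht0 (hsub r hr)) (hc.2.2.mono hsub) (hbcinf t ht0.le)
      (fun b hb => le_trans ?_ (hext t b ht hb)) (by linarith)
    refine hwm.integral_le_energy ht0 (by linarith) hb ?_ (fun r hr => ?_)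
    · refine ((hc.2.2.pow 2).add ?_).mul continuousOn_id
      exact ((Real.continuous_sin.comp_continuousOn hc.1).pow 2).div (by fun_prop)
        (fun r hr => pow_ne_zero 2 (ne_of_gt hr))
    · refine mul_le_mul_of_nonneg_right ?_ hr.le
      nlinarith [sq_nonneg (pT ψ t r)]
  have hE : ∫ r in (t - A)..(t + W), eDen ψ t r ≤ totE ψ 0 := by
    rw [← hcons t ht0.le]
    exact hfe.integral_le ht0.le le_rfl (by linarith) (by linarith)
  have hnear := hwm.abs_sub_le ht0 (show 0 < t - A by linarith)
    (show t - A ≤ t + W by linarith) hs0 hE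
  have h1 : totE ψ 0 / (2 * s) ≤ θ / 2 := by
    rw [div_le_div_iff₀ (by positivity) two_pos, hs]
    field_simp
    linarith
  have h2 : s * (t + W - (t - A)) / (2 * (t - A)) ≤ θ / 2 := by
    rw [div_le_div_iff₀ (by linarith) two_pos]
    have h3 : s * (W + A) / θ ≤ t - A := by linarith
    rw [div_le_iff₀ hθ] at h3
    nlinarith
  have h4 : |ψ t (t - A) - k * Real.pi| ≤
      |ψ t (t + W) - ψ t (t - A)| + |ψ t (t + W) - k * Real.pi| := by
    rw [abs_sub_comm (ψ t (t + W)) (ψ t (t - A))]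
    exact _root_.abs_sub_le _ _ _
  linarith

/-- The squared `H × L²` norm over an annulus, for a wave map close to `kπ` there. -/
theorem IsWaveMap.hl2Sq_le {ψ : ℝ → ℝ → ℝ} {k : ℤ} (hwm : IsWaveMap ψ) {t a b θ δ : ℝ}
    (ht : 0 < t) (ha : 0 < a) (hab : a ≤ b)
    (hδ : ∫ r in a..b, eDen ψ t r ≤ δ) (hθ : ∀ r ∈ Icc a b, |ψ t r - k * Real.pi| ≤ θ) :
    hl2Sq (fun r => ψ t r - k * Real.pi) (pT ψ t) (Icc a b) ≤ δ + (b - a) * (θ ^ 2 / a) := by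
  have hs : Icc a b ⊆ Ioi 0 := fun r hr => ha.trans_le hr.1
  obtain ⟨h0, h1, h2⟩ := hwm.continuousOn_slice ht
  have hden : ∀ r, hl2Den (fun r => ψ t r - k * Real.pi) (pT ψ t) r =
      ((pT ψ t r) ^ 2 + (pR ψ t r) ^ 2 + (ψ t r - k * Real.pi) ^ 2 / r ^ 2) * r := fun r => by
    simp only [hl2Den, deriv_sub_const_fun, pR]
  unfold hl2Sq
  rw [integral_Icc_eq_integral_Ioc, ← intervalIntegral.integral_of_le hab]
  simp only [hden]
  have hc : ContinuousOn (fun r => ((pT ψ t r) ^ 2 + (pR ψ t r) ^ 2 +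
      (ψ t r - k * Real.pi) ^ 2 / r ^ 2) * r) (Ioi 0) := by
    refine (((h1.pow 2).add (h2.pow 2)).add ?_).mul continuousOn_id
    exact ((h0.sub continuousOn_const).pow 2).div (by fun_prop)
      (fun r hr => pow_ne_zero 2 (ne_of_gt hr))
  have he := ((hwm.continuousOn_eDen ht).mono hs).intervalIntegrable_of_Icc (μ := volume) hab
  calc ∫ r in a..b, ((pT ψ t r) ^ 2 + (pR ψ t r) ^ 2 + (ψ t r - k * Real.pi) ^ 2 / r ^ 2) * r
      ≤ ∫ r in a..b, (eDen ψ t r + θ ^ 2 / a) := by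
        refine intervalIntegral.integral_mono_on hab
          ((hc.mono hs).intervalIntegrable_of_Icc hab) (he.add intervalIntegrable_const)
          (fun r hr => ?_)
        have hr0 : 0 < r := hs hr
        have h3 : (ψ t r - k * Real.pi) ^ 2 / r ^ 2 * r ≤ θ ^ 2 / a := by
          have : (ψ t r - k * Real.pi) ^ 2 / r ^ 2 * r = (ψ t r - k * Real.pi) ^ 2 / r := by
            field_simp
          rw [this]
          refine div_le_div₀ (sq_nonneg _) ?_ ha hr.1
          rw [← sq_abs]
          exact pow_le_pow_left₀ (abs_nonneg _) (hθ r hr) 2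
        have h4 : 0 ≤ (Real.sin (ψ t r)) ^ 2 / r ^ 2 * r := by positivity
        unfold eDen
        linarith
    _ = (∫ r in a..b, eDen ψ t r) + (b - a) * (θ ^ 2 / a) := by
        rw [intervalIntegral.integral_add he intervalIntegrable_const,
          intervalIntegral.integral_const, smul_eq_mul]
    _ ≤ δ + (b - a) * (θ ^ 2 / a) := by linarith

/-- decay of the `H × L²` norm of `ψ⃗(t) − (kπ,0)` in the region `λt ≤ r ≤ t − A`. -/
theorem stmt4_hl2_decay_self_similar_region
    (ψ : ℝ → ℝ → ℝ) (k : ℤ)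
    (hwm : IsWaveMap ψ) (hfe : FiniteEnergy ψ) (hcons : EnergyConserved ψ)
    (hbcinf : ∀ t : ℝ, 0 ≤ t → Filter.Tendsto (ψ t) Filter.atTop (nhds (k * Real.pi)))
    (lam : ℝ) (hlam0 : 0 < lam) (hlam1 : lam < 1) :
    ∀ ε > 0, ∃ A₀ > 0, ∀ A : ℝ, A₀ ≤ A →
      Filter.limsup
        (fun t : ℝ => hl2Sq (fun r => ψ t r - k * Real.pi) (pT ψ t)
          (Set.Icc (lam * t) (t - A)))
        Filter.atTop ≤ ε := by
  intro ε hε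
  set θ : ℝ := min 1 (min (ε / 2) (ε / 2 * lam) / 9) with hθdef
  have hθ0 : 0 < θ := by positivity
  have hθ1 : θ ≤ 1 := min_le_left _ _
  have hθ2 : 9 * θ ≤ ε / 2 * lam := by
    have h1 : θ ≤ min (ε / 2) (ε / 2 * lam) / 9 := min_le_right _ _
    have h2 : min (ε / 2) (ε / 2 * lam) ≤ ε / 2 * lam := min_le_right _ _
    linarith
  set δ : ℝ := min (ε / 2) (lam * θ ^ 2) with hδdef
  have hδ0 : 0 < δ := by positivity
  have hδ1 : δ ≤ ε / 2 := min_le_left _ _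
  have hδ2 : δ ≤ lam * θ ^ 2 := min_le_right _ _
  obtain ⟨A₀, hA₀, hdecay⟩ := hwm.isNullPair.exists_slice_le (by norm_num)
    (energyLE_of_conserved hfe hcons) hlam0 hlam1 hδ0
  refine ⟨A₀, hA₀, fun A hA => ?_⟩
  have hnonneg : ∀ t : ℝ, 0 ≤ t → 0 ≤ hl2Sq (fun r => ψ t r - k * Real.pi) (pT ψ t)
      (Set.Icc (lam * t) (t - A)) := fun t ht =>
    setIntegral_nonneg measurableSet_Icc fun r hr =>
      mul_nonneg (by positivity) ((mul_nonneg hlam0.le ht).trans hr.1)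
  refine limsup_le_of_le
    (isCoboundedUnder_le_of_eventually_le atTop ((eventually_ge_atTop 0).mono hnonneg)) ?_
  filter_upwards [hdecay A hA,
    hwm.eventually_abs_sub_int_mul_pi_le (A := A) hfe hcons hbcinf hθ0
      (hθ1.trans (by linarith [Real.pi_gt_three])),
    eventually_gt_atTop 0, eventually_ge_atTop (A / (1 - lam))] with t hen hedge ht htA
  have hlt : 0 < lam * t := by positivity
  have hab : lam * t ≤ t - A := by
    rw [div_le_iff₀ (by linarith)] at htA
    linarith
  rw [integral_slice_eq_integral_eDen, show t - (1 - lam) * t = lam * t by ring] at hen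
  have hsubE : ∀ r ∈ Set.Icc (lam * t) (t - A), ∫ x in r..(t - A), eDen ψ t x ≤ δ := by
    intro r hr
    have hsub : Icc (lam * t) (t - A) ⊆ Ioi 0 := fun x hx => hlt.trans_le hx.1
    have hnn : ∀ x ∈ Ioc (lam * t) (t - A), 0 ≤ eDen ψ t x := fun x hx =>
      eDen_nonneg ψ t (hlt.le.trans hx.1.le)
    have h1 : ∫ x in r..(t - A), eDen ψ t x ≤ ∫ x in (lam * t)..(t - A), eDen ψ t x := by
      refine intervalIntegral.integral_mono_interval hr.1 hr.2 le_rfl ?_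
        (((hwm.continuousOn_eDen ht).mono hsub).intervalIntegrable_of_Icc hab)
      filter_upwards [ae_restrict_mem measurableSet_Ioc] with x hx using hnn x hx
    have h2 : 0 ≤ ∫ x in (lam * t)..(t - A), eDen ψ t x :=
      intervalIntegral.integral_nonneg hab fun x hx => eDen_nonneg ψ t (hlt.le.trans hx.1)
    linarith
  have hclose : ∀ r ∈ Set.Icc (lam * t) (t - A), |ψ t r - k * Real.pi| ≤ 3 * θ := by
    intro r hr
    have hr0 : 0 < r := hlt.trans_le hr.1
    have h1 := hwm.abs_sub_le ht hr0 hr.2 (show 0 < lam * θ by positivity) (hsubE r hr)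
    have h2 : δ / (2 * (lam * θ)) ≤ θ / 2 := by
      rw [div_le_div_iff₀ (by positivity) two_pos]
      nlinarith
    have h3 : lam * θ * (t - A - r) / (2 * r) ≤ θ / 2 := by
      rw [div_le_div_iff₀ (by positivity) two_pos]
      have : lam * (t - A - r) ≤ r := by nlinarith [hr.1]
      nlinarith
    have h4 : |ψ t r - k * Real.pi| ≤
        |ψ t (t - A) - ψ t r| + |ψ t (t - A) - k * Real.pi| := by
      rw [abs_sub_comm (ψ t (t - A)) (ψ t r)]
      exact _root_.abs_sub_le _ _ _
    linarith
  refine (hwm.hl2Sq_le ht hlt hab (hsubE _ ⟨le_rfl, hab⟩) hclose).trans ?_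
  have h5 : (t - A - lam * t) * ((3 * θ) ^ 2 / (lam * t)) ≤ ε / 2 := by
    rw [← mul_div_assoc, div_le_iff₀ hlt]
    have h6 : (3 * θ) ^ 2 ≤ ε / 2 * lam := by nlinarith
    have h7 : t - A - lam * t ≤ t := by linarith
    nlinarith [mul_le_mul h7 h6 (sq_nonneg _) ht.le]
  linarith
end
end

section
/- Let ψ be a smooth global finite-energy 1-equivariant wave map whose initial data (ψ₀,ψ₁) = ψ⃗(0) satisfy supp(∂_rψ₀) ⊆ (0,R] and supp(ψ₁) ⊆ (0,R] for some R > 0, and assume (as guaranteed by finite speed of propagation) that ∂_rψ(t,·) is supported in (0, R+t] for every t ≥ 0. Then for every t ≥ 0 and every 0 ≤ A < t, sup_{r ≥ t−A} |ψ(t,r) − ψ(t,∞)| ≤ √(E(ψ⃗)) · √((A+R)/(t−A)). -/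
open MeasureTheory Real Filter Set

noncomputable section

/-- Radial slices of a wave map are continuously differentiable away from the origin. -/
theorem IsWaveMap.contDiffOn_slice {ψ : ℝ → ℝ → ℝ} (hwm : IsWaveMap ψ) {t : ℝ} (ht : 0 ≤ t) :
    ContDiffOn ℝ 1 (ψ t) (Set.Ioi 0) := by
  have h : ContDiffOn ℝ 1 (fun p : ℝ × ℝ => ψ p.1 p.2) (Set.Ici (0:ℝ) ×ˢ Set.Ioi (0:ℝ)) :=
    hwm.1.of_le (by exact_mod_cast le_top)
  have hg : ContDiffOn ℝ 1 (fun ρ : ℝ => (t, ρ)) (Set.Ioi 0) :=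
    (contDiff_const.prodMk contDiff_id).contDiffOn
  exact h.comp hg fun ρ hρ => ⟨ht, hρ⟩

/-- Weighted Cauchy–Schwarz bound for the increment of a `C¹` function on `[a, b]`, `a > 0`. -/
theorem mul_sq_sub_le_mul_integral_deriv_sq {f : ℝ → ℝ} (hf : ContDiffOn ℝ 1 f (Set.Ioi 0))
    {a b : ℝ} (ha : 0 < a) (hab : a < b) :
    a * (f b - f a) ^ 2 ≤ (b - a) * ∫ ρ in a..b, (deriv f ρ) ^ 2 * ρ := by
  have hL : 0 < b - a := sub_pos.2 hab
  have hsub : Set.uIcc a b ⊆ Set.Ioi 0 := fun x hx => by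
    rw [Set.uIcc_of_le hab.le] at hx
    exact ha.trans_le hx.1
  have hdc : ContinuousOn (deriv f) (Set.uIcc a b) :=
    (hf.continuousOn_deriv_of_isOpen isOpen_Ioi le_rfl).mono hsub
  have hFTC : ∫ ρ in a..b, deriv f ρ = f b - f a :=
    intervalIntegral.integral_deriv_eq_sub
      (fun x hx => (hf.differentiableOn one_ne_zero).differentiableAt
        (isOpen_Ioi.mem_nhds (hsub hx)))
      hdc.intervalIntegrable
  set c := (f b - f a) / (b - a) with hc
  have hmono : ∫ ρ in a..b, a * (2 * c * deriv f ρ - c ^ 2) ≤ ∫ ρ in a..b, (deriv f ρ) ^ 2 * ρ := by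
    apply intervalIntegral.integral_mono_on hab.le
    · exact ContinuousOn.intervalIntegrable (by fun_prop)
    · exact ContinuousOn.intervalIntegrable (by fun_prop)
    · intro x hx
      nlinarith [mul_nonneg ha.le (sq_nonneg (deriv f x - c)),
        mul_nonneg (sub_nonneg.2 hx.1) (sq_nonneg (deriv f x))]
  rw [intervalIntegral.integral_const_mul, intervalIntegral.integral_sub
    (hdc.intervalIntegrable.const_mul _) intervalIntegrable_const,
    intervalIntegral.integral_const_mul, hFTC, intervalIntegral.integral_const, smul_eq_mul]
    at hmono
  have hcL : c * (b - a) = f b - f a := div_mul_cancel₀ _ hL.ne'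
  calc a * (f b - f a) ^ 2
      = (b - a) * (a * (2 * c * (f b - f a) - (b - a) * c ^ 2)) := by rw [← hcL]; ring
    _ ≤ _ := mul_le_mul_of_nonneg_left hmono hL.le

/-- The energy controls the weighted `L²` norm of the radial derivative on any annulus. -/
theorem integral_deriv_sq_le_totE {ψ : ℝ → ℝ → ℝ} {t a b : ℝ}
    (hf : ContDiffOn ℝ 1 (ψ t) (Set.Ioi 0)) (hint : IntegrableOn (eDen ψ t) (Set.Ioi 0))
    (ha : 0 < a) (hab : a ≤ b) :
    ∫ ρ in a..b, (deriv (ψ t) ρ) ^ 2 * ρ ≤ totE ψ t := by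
  have hsub : Set.Ioc a b ⊆ Set.Ioi 0 := fun x hx => ha.trans hx.1
  have hdc : ContinuousOn (deriv (ψ t)) (Set.uIcc a b) :=
    (hf.continuousOn_deriv_of_isOpen isOpen_Ioi le_rfl).mono fun x hx => by
      rw [Set.uIcc_of_le hab] at hx
      exact ha.trans_le hx.1
  have hi : IntervalIntegrable (fun ρ => (deriv (ψ t) ρ) ^ 2 * ρ) volume a b :=
    ContinuousOn.intervalIntegrable (by fun_prop)
  rw [intervalIntegral.integral_of_le hab]
  calc ∫ ρ in Set.Ioc a b, (deriv (ψ t) ρ) ^ 2 * ρ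
      ≤ ∫ ρ in Set.Ioc a b, eDen ψ t ρ := by
        refine setIntegral_mono_on hi.1 (hint.mono_set hsub) measurableSet_Ioc fun x hx => ?_
        refine mul_le_mul_of_nonneg_right ?_ (hsub hx).le
        have h1 : 0 ≤ (pT ψ t x) ^ 2 := sq_nonneg _
        have h2 : 0 ≤ (Real.sin (ψ t x)) ^ 2 / x ^ 2 := by positivity
        have h3 : pR ψ t x = deriv (ψ t) x := rfl
        rw [h3]
        linarith
    _ ≤ totE ψ t := by
        refine setIntegral_mono_set hint ?_ hsub.eventuallyLE
        filter_upwards [ae_restrict_mem measurableSet_Ioi] with x hx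
        have : (0:ℝ) < x := hx
        simp only [eDen, Pi.zero_apply]
        positivity

/-- A function whose derivative vanishes beyond `b` equals its limit at infinity from `b` on. -/
theorem eq_of_tendsto_of_deriv_eq_zero {f : ℝ → ℝ} {b l : ℝ}
    (hf : DifferentiableOn ℝ f (Set.Ioi 0)) (hb : 0 < b) (hd : ∀ r, b < r → deriv f r = 0)
    (hlim : Tendsto f atTop (nhds l)) {r : ℝ} (hr : b ≤ r) : f r = l := by
  have hconst : ∀ s, r ≤ s → f s = f r := fun s hs => by
    rcases hs.eq_or_lt with rfl | hs
    · rfl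
    have hpos : Set.Icc r s ⊆ Set.Ioi 0 := fun x hx => hb.trans_le (hr.trans hx.1)
    obtain ⟨c, hc, h⟩ := exists_deriv_eq_slope f hs (hf.continuousOn.mono hpos)
      (hf.mono (Set.Ioo_subset_Icc_self.trans hpos))
    rw [hd c (hr.trans_lt hc.1), eq_comm, div_eq_zero_iff] at h
    rcases h with h | h <;> linarith
  exact tendsto_nhds_unique (tendsto_const_nhds.congr'
    ((eventually_ge_atTop r).mono fun s hs => (hconst s hs).symm)) hlim

/-- pointwise bound outside the cone for compactly supported data. -/
theorem stmt5_exterior_pointwise_bound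
    (ψ : ℝ → ℝ → ℝ) (R : ℝ) (ℓ : ℝ → ℝ)
    (hwm : IsWaveMap ψ) (hfe : FiniteEnergy ψ) (hcons : EnergyConserved ψ)
    (hR : 0 < R)
    (hsupp0 : ∀ r : ℝ, R < r → deriv (ψ 0) r = 0)
    (hsupp1 : ∀ r : ℝ, R < r → pT ψ 0 r = 0)
    (hsupp : ∀ t : ℝ, 0 ≤ t → ∀ r : ℝ, R + t < r → deriv (ψ t) r = 0)
    (hlim : ∀ t : ℝ, 0 ≤ t → Filter.Tendsto (ψ t) Filter.atTop (nhds (ℓ t))) :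
    ∀ t : ℝ, 0 ≤ t → ∀ A : ℝ, 0 ≤ A → A < t → ∀ r : ℝ, t - A ≤ r →
      |ψ t r - ℓ t| ≤ Real.sqrt (totE ψ 0) * Real.sqrt ((A + R) / (t - A)) := by
  intro t ht A hA hAt r hr
  have hr0 : 0 < r := (sub_pos.2 hAt).trans_le hr
  have hC := hwm.contDiffOn_slice ht
  have hend : ∀ s, R + t ≤ s → ψ t s = ℓ t := fun s hs =>
    eq_of_tendsto_of_deriv_eq_zero (hC.differentiableOn one_ne_zero) (by positivity)
      (hsupp t ht) (hlim t ht) hs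
  rcases le_or_gt (R + t) r with h | h
  · rw [hend r h, sub_self, abs_zero]
    positivity
  have hI := integral_deriv_sq_le_totE hC (hfe t ht) hr0 h.le
  have hCS := mul_sq_sub_le_mul_integral_deriv_sq hC hr0 h
  rw [hcons t ht] at hI
  rw [hend _ le_rfl] at hCS
  have hE : 0 ≤ totE ψ 0 := by
    refine le_trans (intervalIntegral.integral_nonneg h.le fun x hx => ?_) hI
    exact mul_nonneg (sq_nonneg _) (hr0.le.trans hx.1)
  rw [← Real.sqrt_mul hE]
  refine Real.abs_le_sqrt ?_
  have htA : 0 < t - A := sub_pos.2 hAt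
  calc (ψ t r - ℓ t) ^ 2 ≤ totE ψ 0 * ((R + t - r) / r) := by
        rw [← mul_div_assoc, le_div_iff₀ hr0]
        nlinarith [mul_le_mul_of_nonneg_left hI (sub_nonneg.2 h.le)]
    _ ≤ totE ψ 0 * ((A + R) / (t - A)) := by
        gcongr
        linarith
end
end
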